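/- arXiv:1705.00167 — 3 statements merged into one kernel-verified Lean document; each statement's English description precedes it below -/
import Mathlib

section
/- Let σ = (σ_n)_{n≥0} be an everywhere growing directive sequence of non-erasing morphisms σ_n: 𝒜_{n+1} → 𝒜_n⁺ with liminf_{n→∞} |𝒜_n| < ∞. Then σ is eventually recognizable for aperiodic points: there exists n₀ such that for every n ≥ n₀, every aperiodic point y ∈ 𝒜_n^ℤ has at most one centered σ_n-representation (k,x) with x ∈ X^(n+1)_σ. -/
open scoped BigOperators

namespace Recog

variable {A B C : Type*}

/-- A morphism assigning a word to each letter is non-erasing if every image is nonempty. -/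
def NonErasing (σ : A → List B) : Prop := ∀ a, σ a ≠ []

/-- Apply a morphism letterwise to a finite word, concatenating the images. -/
def wordApply (σ : A → List B) : List A → List B
  | [] => []
  | a :: w => σ a ++ wordApply σ w

/-- Composition of morphisms `τ ∘ σ`. -/
def comp (τ : B → List C) (σ : A → List B) : A → List C := fun a => wordApply τ (σ a)

/-- The `ℓ`-th cutting point of the representation `(0, x)`:
`|σ(x_[0,ℓ))|` for `ℓ ≥ 0` and `-|σ(x_[ℓ,0))|` for `ℓ < 0`. -/
def cut (σ : A → List B) (x : ℤ → A) (ℓ : ℤ) : ℤ :=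
  if 0 ≤ ℓ then ∑ i ∈ Finset.range ℓ.toNat, ((σ (x i)).length : ℤ)
  else -∑ i ∈ Finset.range (-ℓ).toNat, ((σ (x (-(i : ℤ) - 1))).length : ℤ)

/-- `y` is the bi-infinite image `σ(x)`, where `σ(x₀)` starts at position `0`. -/
def IsSubstPt (σ : A → List B) (x : ℤ → A) (y : ℤ → B) : Prop :=
  ∀ (ℓ : ℤ) (j : ℕ) (hj : j < (σ (x ℓ)).length),
    y (cut σ x ℓ + j) = (σ (x ℓ)).get ⟨j, hj⟩

/-- `(k, x)` is a `σ`-representation of `y`, i.e. `y = T^k σ(x)`. -/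
def IsRep (σ : A → List B) (y : ℤ → B) (k : ℤ) (x : ℤ → A) : Prop :=
  IsSubstPt σ x fun n => y (n - k)

/-- `(k, x)` is a centered `σ`-representation of `y`: `y = T^k σ(x)` with `0 ≤ k < |σ(x₀)|`. -/
def IsCenteredRep (σ : A → List B) (y : ℤ → B) (k : ℤ) (x : ℤ → A) : Prop :=
  IsRep σ y k x ∧ 0 ≤ k ∧ k < ((σ (x 0)).length : ℤ)

/-- `y` is aperiodic: `T^p y ≠ y` for all `p ≥ 1`. -/
def Aperiodic (y : ℤ → B) : Prop := ∀ p : ℕ, 1 ≤ p → (fun n => y (n + p)) ≠ y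

/-- `y` is periodic: `T^p y = y` for some `p ≥ 1`. -/
def Periodic (y : ℤ → B) : Prop := ∃ p : ℕ, 1 ≤ p ∧ (fun n => y (n + p)) = y

/-- The set of `σ`-cutting points of the representation `(k, x)`. -/
def cutSet (σ : A → List B) (x : ℤ → A) (k : ℤ) : Set ℤ :=
  {m : ℤ | ∃ ℓ : ℤ, m = cut σ x ℓ - k}

/-- `σ` is recognizable in `X`: every `y` has at most one centered `σ`-representation in `X`. -/
def RecIn (σ : A → List B) (X : Set (ℤ → A)) : Prop :=
  ∀ (y : ℤ → B) (k k' : ℤ) (x x' : ℤ → A), x ∈ X → x' ∈ X →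
    IsCenteredRep σ y k x → IsCenteredRep σ y k' x' → k = k' ∧ x = x'

/-- `σ` is recognizable in `X` for aperiodic points. -/
def RecInAp (σ : A → List B) (X : Set (ℤ → A)) : Prop :=
  ∀ y : ℤ → B, Aperiodic y → ∀ (k k' : ℤ) (x x' : ℤ → A), x ∈ X → x' ∈ X →
    IsCenteredRep σ y k x → IsCenteredRep σ y k' x' → k = k' ∧ x = x'

/-- `σ` is left permutative: the first letters of `σ a` and `σ b` differ for distinct `a, b`. -/
def LeftPermutative (σ : A → List B) : Prop :=
  ∀ a b : A, a ≠ b → (σ a).head? ≠ (σ b).head?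

/-- `σ` is right permutative: the last letters of `σ a` and `σ b` differ for distinct `a, b`. -/
def RightPermutative (σ : A → List B) : Prop :=
  ∀ a b : A, a ≠ b → (σ a).getLast? ≠ (σ b).getLast?

/-- `σ` and `σ'` are rotationally conjugate. -/
def RotConj (σ σ' : A → List B) : Prop :=
  ∃ w : List B, (∀ a, σ a ++ w = w ++ σ' a) ∨ (∀ a, w ++ σ a = σ' a ++ w)

/-- The incidence matrix of `σ`, over `ℚ`: entry `(b, a)` counts occurrences of `b` in `σ a`. -/
noncomputable def incidence (σ : A → List B) [DecidableEq B] : Matrix B A ℚ :=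
  Matrix.of fun b a => ((σ a).count b : ℚ)

/-- The finite subword `x_[i, i+m)` of a bi-infinite sequence. -/
def factor (x : ℤ → A) (i : ℤ) (m : ℕ) : List A := (List.range m).map fun j => x (i + j)

/-- The language of a bi-infinite sequence: the set of its finite subwords. -/
def lang (x : ℤ → A) : Set (List A) := {w | ∃ (i : ℤ) (m : ℕ), w = factor x i m}

/-- `σ` is injective on bi-infinite sequences. -/
def InjZ (σ : A → List B) : Prop :=
  ∀ (x x' : ℤ → A) (y : ℤ → B), IsSubstPt σ x y → IsSubstPt σ x' y → x = x'

/-- Cutting points for one-sided sequences. -/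
def cutN (σ : A → List B) (x : ℕ → A) (ℓ : ℕ) : ℕ :=
  ∑ i ∈ Finset.range ℓ, (σ (x i)).length

/-- `y` is the one-sided image `σ(x)` for `x : ℕ → A`. -/
def IsSubstPtN (σ : A → List B) (x : ℕ → A) (y : ℕ → B) : Prop :=
  ∀ (ℓ j : ℕ) (hj : j < (σ (x ℓ)).length),
    y (cutN σ x ℓ + j) = (σ (x ℓ)).get ⟨j, hj⟩

/-- `σ` is injective on one-sided (right-infinite) sequences. -/
def InjN (σ : A → List B) : Prop :=
  ∀ (x x' : ℕ → A) (y : ℕ → B), IsSubstPtN σ x y → IsSubstPtN σ x' y → x = x'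

/-- The total length `⦀σ⦀ = Σ_a |σ a|`. -/
def totalLen (σ : A → List B) [Fintype A] : ℕ := ∑ a, (σ a).length

/-- `X` is invariant under the two-sided shift. -/
def ShiftInvariant (X : Set (ℤ → A)) : Prop :=
  ∀ x ∈ X, (fun n => x (n + 1)) ∈ X ∧ (fun n => x (n - 1)) ∈ X

/-- The iterate `σ^n` of a substitution, applied to a letter. -/
def iter (σ : A → List A) : ℕ → A → List A
  | 0, a => [a]
  | n + 1, a => wordApply (iter σ n) (σ a)

/-- The language `ℒ_σ` of a substitution: subwords of the `σ^n(a)`. -/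
def subLang (σ : A → List A) : Set (List A) := {w | ∃ (n : ℕ) (a : A), w <:+: iter σ n a}

/-- The substitutive shift `X_σ`. -/
def subX (σ : A → List A) : Set (ℤ → A) := {x | ∀ w ∈ lang x, w ∈ subLang σ}

/-- `σ` is recognizable in the sense of Mossé for `x`. -/
def MosseRec (σ : A → List B) (x : ℤ → A) : Prop :=
  ∃ ℓ : ℕ, ∀ y : ℤ → B, IsSubstPt σ x y →
    ∀ m ∈ cutSet σ x 0, ∀ m' : ℤ,
      factor y (m - ℓ) (2 * ℓ) = factor y (m' - ℓ) (2 * ℓ) → m' ∈ cutSet σ x 0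

section Sadic

variable {𝒜 : ℕ → Type*}

/-- `block σ N = σ_[0,N)`, mapping a letter of `𝒜 N` to a word over `𝒜 0`. -/
def block (σ : ∀ n, 𝒜 (n + 1) → List (𝒜 n)) : ∀ N, 𝒜 N → List (𝒜 0)
  | 0, a => [a]
  | N + 1, a => wordApply (block σ N) (σ N a)

/-- `blockFrom σ n k = σ_[n,n+k)`, mapping a letter of `𝒜 (n+k)` to a word over `𝒜 n`. -/
def blockFrom (σ : ∀ n, 𝒜 (n + 1) → List (𝒜 n)) (n k : ℕ) : 𝒜 (n + k) → List (𝒜 n) :=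
  block (𝒜 := fun m => 𝒜 (n + m)) (fun m => σ (n + m)) k

/-- The language `ℒ^(n)_σ` of a directive sequence. -/
def sadicLang (σ : ∀ n, 𝒜 (n + 1) → List (𝒜 n)) (n : ℕ) : Set (List (𝒜 n)) :=
  {w | ∃ (k : ℕ) (a : 𝒜 (n + k)), 1 ≤ k ∧ w <:+: blockFrom σ n k a}

/-- The shift `X^(n)_σ` of a directive sequence. -/
def sadicX (σ : ∀ n, 𝒜 (n + 1) → List (𝒜 n)) (n : ℕ) : Set (ℤ → 𝒜 n) :=
  {x | ∀ w ∈ lang x, w ∈ sadicLang σ n}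

/-- A directive sequence is everywhere growing if `min_a |σ_[0,n)(a)| → ∞`. -/
def EverywhereGrowing (σ : ∀ n, 𝒜 (n + 1) → List (𝒜 n)) : Prop :=
  ∀ m : ℕ, ∃ N : ℕ, ∀ n ≥ N, ∀ a : 𝒜 n, m ≤ (block σ n a).length

end Sadic

end Recog

namespace RecogAux
open Recog
universe u v
set_option linter.unusedSectionVars false

section words
variable {A B C D : Type*}

theorem wordApply_append (f : A → List B) (s t : List A) :
    wordApply f (s ++ t) = wordApply f s ++ wordApply f t := by
  induction s with
  | nil => rfl
  | cons a s ih => simp [wordApply, ih]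

theorem wordApply_comp (τ : B → List C) (f : A → List B) (s : List A) :
    wordApply (comp τ f) s = wordApply τ (wordApply f s) := by
  induction s with
  | nil => rfl
  | cons a s ih => simp [wordApply, ih, wordApply_append, comp]

theorem wordApply_map (f : B → List C) (g : A → B) (s : List A) :
    wordApply f (s.map g) = wordApply (fun a => f (g a)) s := by
  induction s with
  | nil => rfl
  | cons a s ih => simp [wordApply, ih]

theorem wordApply_singleton (f : A → List B) (a : A) : wordApply f [a] = f a := by
  simp [wordApply]

theorem wordApply_ne_nil (f : A → List B) (hf : NonErasing f) (s : List A) (hs : s ≠ []) :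
    wordApply f s ≠ [] := by
  cases s with
  | nil => exact absurd rfl hs
  | cons a s => simp [wordApply, hf a]

theorem length_le_wordApply (f : A → List B) (hf : NonErasing f) (s : List A) :
    s.length ≤ (wordApply f s).length := by
  induction s with
  | nil => simp [wordApply]
  | cons a s ih =>
    have := List.length_pos_iff.2 (hf a)
    simp [wordApply]; omega

end words

/-- factorization through a small alphabet -/
def Fac {D : Type u} {B : Type v} (ψ : D → List B) (r : ℕ) : Prop :=
  ∃ (E : Type u) (_ : Fintype E) (α : E → List B) (β : D → List E),
    Fintype.card E ≤ r ∧ NonErasing α ∧ ψ = comp α β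

theorem Fac.comp {D' D : Type u} {B : Type v} {ψ : D → List B} {r : ℕ} (h : Fac ψ r)
    (τ : D' → List D) : Fac (comp ψ τ) r := by
  obtain ⟨E, _, α, β, h1, h2, rfl⟩ := h
  refine ⟨E, _, α, Recog.comp β τ, h1, h2, ?_⟩
  funext d
  exact wordApply_comp α β (τ d)

/-- finite-length relation -/
def Rel {D : Type u} {B : Type v} (ψ : D → List B) (N : ℕ) (p q : D) : Prop :=
  ∃ (s s' : List D) (t t' : List B), N ≤ s.length ∧ N ≤ s'.length ∧
    wordApply ψ (p :: s) ++ t = wordApply ψ (q :: s') ++ t'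

theorem Rel.symm {D : Type u} {B : Type v} {ψ : D → List B} {N : ℕ} {p q : D}
    (h : Rel ψ N p q) : Rel ψ N q p := by
  obtain ⟨s, s', t, t', h1, h2, h3⟩ := h
  exact ⟨s', s, t', t, h2, h1, h3.symm⟩

theorem Rel.prefix {D : Type u} {B : Type v} {ψ : D → List B} {N : ℕ} {p q : D}
    (h : Rel ψ N p q) : (∃ u, ψ q = ψ p ++ u) ∨ (∃ u, ψ p = ψ q ++ u) := by
  obtain ⟨s, s', t, t', h1, h2, h3⟩ := h
  simp only [wordApply, List.append_assoc] at h3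
  rcases List.append_eq_append_iff.1 h3 with ⟨u, h, _⟩ | ⟨u, h, _⟩
  · exact Or.inl ⟨u, h⟩
  · exact Or.inr ⟨u, h⟩

section step
variable {D : Type u} {B : Type v} [DecidableEq D]

def tau (a b : D) : D → List D := fun d => if d = b then [a, b] else [d]
def tau1 (a b : D) : D → D := fun d => if d = b then a else d

theorem tau_nonErasing (a b : D) : NonErasing (tau a b) := by
  intro d; unfold tau; split <;> simp

theorem tau_cons (a b c : D) (s : List D) :
    ∃ t, wordApply (tau a b) (c :: s) = tau1 a b c :: t ∧ s.length ≤ t.length := by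
  have := length_le_wordApply (tau a b) (tau_nonErasing a b) s
  by_cases h : c = b
  · refine ⟨b :: wordApply (tau a b) s, by simp [wordApply, tau, tau1, h], by simp; omega⟩
  · exact ⟨wordApply (tau a b) s, by simp [wordApply, tau, tau1, h], this⟩

theorem comp_tau {ψ : D → List B} {a b : D} (hab : a ≠ b) {u : List B} (hu : ψ b = ψ a ++ u) :
    ψ = comp (Function.update ψ b u) (tau a b) := by
  funext d
  by_cases h : d = b
  · subst h; simp [comp, tau, wordApply, hab, hu]
  · simp [comp, tau, wordApply, h]

theorem step1 {ψ : D → List B} {a b : D} (hab : a ≠ b) {u : List B} (hu : ψ b = ψ a ++ u)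
    {N : ℕ} (h : Rel ψ (N + 1) a b) : ∃ c, c ≠ b ∧ Rel (Function.update ψ b u) N c b := by
  obtain ⟨s, s', t, t', h1, h2, h3⟩ := h
  cases s with
  | nil => simp at h1
  | cons c s =>
    obtain ⟨w, hw, hl⟩ := tau_cons a b c s
    refine ⟨tau1 a b c, ?_, w, wordApply (tau a b) s', t, t', ?_, ?_, ?_⟩
    · unfold tau1; split <;> assumption
    · simp at h1; omega
    · have := length_le_wordApply (tau a b) (tau_nonErasing a b) s'
      omega
    · rw [← hw]
      have e : ∀ l, wordApply (Function.update ψ b u) (wordApply (tau a b) l) = wordApply ψ l := by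
        intro l
        rw [← wordApply_comp, ← comp_tau hab hu]
      have e2 : wordApply (Function.update ψ b u) (b :: wordApply (tau a b) s')
          = u ++ wordApply ψ s' := by
        rw [wordApply, e]; simp
      rw [e, e2]
      change ψ a ++ wordApply ψ (c :: s) ++ t = ψ b ++ wordApply ψ s' ++ t' at h3
      rw [hu] at h3
      simpa using h3

theorem step2 {ψ : D → List B} {a b : D} (hab : a ≠ b) {u : List B} (hu : ψ b = ψ a ++ u)
    {N : ℕ} {p q : D} (h : Rel ψ (N + 1) p q) :
    Rel (Function.update ψ b u) N (tau1 a b p) (tau1 a b q) := by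
  obtain ⟨s, s', t, t', h1, h2, h3⟩ := h
  obtain ⟨w, hw, hl⟩ := tau_cons a b p s
  obtain ⟨w', hw', hl'⟩ := tau_cons a b q s'
  refine ⟨w, w', t, t', by omega, by omega, ?_⟩
  rw [← hw, ← hw', ← wordApply_comp, ← wordApply_comp, ← comp_tau hab hu]
  exact h3

def pr (a b : D) (hab : a ≠ b) : D → {d : D // d ≠ b} :=
  fun d => if h : d = b then ⟨a, hab⟩ else ⟨d, h⟩

theorem pr_spec {ψ : D → List B} {a b : D} (hab : a ≠ b) (hu : ψ b = ψ a) (d : D) :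
    ψ (pr a b hab d).1 = ψ d := by
  unfold pr; split
  · simp_all
  · rfl

theorem comp_pr {ψ : D → List B} {a b : D} (hab : a ≠ b) (hu : ψ b = ψ a) :
    ψ = comp (fun d : {d : D // d ≠ b} => ψ d.1) (fun d => [pr a b hab d]) := by
  funext d
  simp [comp, wordApply, pr_spec hab hu]

theorem merge {ψ : D → List B} {a b : D} (hab : a ≠ b) (hu : ψ b = ψ a) {N : ℕ} {p q : D}
    (h : Rel ψ N p q) :
    Rel (fun d : {d : D // d ≠ b} => ψ d.1) N (pr a b hab p) (pr a b hab q) := by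
  obtain ⟨s, s', t, t', h1, h2, h3⟩ := h
  refine ⟨s.map (pr a b hab), s'.map (pr a b hab), t, t', by simpa, by simpa, ?_⟩
  rw [← List.map_cons, ← List.map_cons, wordApply_map, wordApply_map]
  simpa only [pr_spec hab hu] using h3

theorem nonErasing_update {ψ : D → List B} (hψ : NonErasing ψ) {b : D} {u : List B} (hu : u ≠ []) :
    NonErasing (Function.update ψ b u) := by
  intro d
  by_cases h : d = b
  · subst h; simpa
  · simpa [h] using hψ d

variable [Fintype D]

theorem totalLen_update {ψ : D → List B} (hψ : NonErasing ψ) {a b : D} {u : List B}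
    (hu : ψ b = ψ a ++ u) : totalLen (Function.update ψ b u) + 1 ≤ totalLen ψ := by
  unfold totalLen
  refine Nat.succ_le_of_lt (Finset.sum_lt_sum ?_ ?_)
  · intro d _
    by_cases h : d = b
    · subst h; simp [hu]
    · simp [h]
  · refine ⟨b, Finset.mem_univ _, ?_⟩
    have := List.length_pos_iff.2 (hψ a)
    simp [hu]; exact this

theorem totalLen_pos {ψ : D → List B} (hψ : NonErasing ψ) (a : D) : 1 ≤ totalLen ψ := by
  have : (ψ a).length ≤ totalLen ψ :=
    Finset.single_le_sum (f := fun d => (ψ d).length) (by intros; simp) (Finset.mem_univ a)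
  have := List.length_pos_iff.2 (hψ a)
  omega

theorem totalLen_sub {ψ : D → List B} (b : D) [Fintype {d : D // d ≠ b}] :
    totalLen (fun d : {d : D // d ≠ b} => ψ d.1) ≤ totalLen ψ := by
  classical
  unfold totalLen
  have : ∑ a : {d : D // d ≠ b}, (ψ a.1).length
      = ∑ a ∈ Finset.univ.map (Function.Embedding.subtype fun d => d ≠ b), (ψ a).length := by
    simp only [Finset.sum_map, Function.Embedding.subtype_apply]
  rw [this]
  exact Finset.sum_le_sum_of_subset (Finset.subset_univ _)

end step

theorem fac_one {B : Type v} : ∀ (N : ℕ) {D : Type u} [Fintype D] (ψ : D → List B)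
    (_ : NonErasing ψ) (_ : totalLen ψ ≤ N) (p q : D) (_ : p ≠ q) (_ : Rel ψ N p q) (r : ℕ)
    (_ : Fintype.card D ≤ r + 1), Fac ψ r := by
  intro N
  induction N with
  | zero =>
    intro D _ ψ h1 h2 p q
    classical
    have := totalLen_pos h1 p
    omega
  | succ N ih =>
    intro D _ ψ h1 h2 p q hpq hrel r hr
    classical
    have key : ∀ a b : D, a ≠ b → ∀ u, ψ b = ψ a ++ u → Rel ψ (N + 1) a b → Fac ψ r := by
      intro a b hab u hu hrel
      by_cases hu0 : u = []
      · subst hu0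
        simp only [List.append_nil] at hu
        refine ⟨{d : D // d ≠ b}, inferInstance, fun d => ψ d.1, fun d => [pr a b hab d], ?_,
          fun d => h1 d.1, comp_pr hab hu⟩
        simp [Fintype.card_subtype_compl]; omega
      · obtain ⟨c, hc, hrel'⟩ := step1 hab hu hrel
        rw [comp_tau hab hu]
        apply Fac.comp
        have := totalLen_update h1 hu
        exact ih _ (nonErasing_update h1 hu0) (by omega) c b hc hrel' r hr
    rcases hrel.prefix with ⟨u, hu⟩ | ⟨u, hu⟩
    · exact key p q hpq u hu hrel
    · exact key q p hpq.symm u hu hrel.symm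

theorem fac_two {B : Type v} : ∀ (N : ℕ) {D : Type u} [Fintype D] (ψ : D → List B)
    (_ : NonErasing ψ) (_ : totalLen ψ ≤ N) (p q p' q' : D) (_ : p ≠ q) (_ : p' ≠ q')
    (_ : ¬ ((p = p' ∧ q = q') ∨ (p = q' ∧ q = p')))
    (_ : Rel ψ N p q) (_ : Rel ψ N p' q') (r : ℕ)
    (_ : Fintype.card D ≤ r + 2), Fac ψ r := by
  intro N
  induction N with
  | zero =>
    intro D _ ψ h1 h2 p q
    classical
    have := totalLen_pos h1 p
    omega
  | succ N ih =>
    intro D _ ψ h1 h2 p q p' q' hpq hpq' hne hrel hrel2 r hr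
    classical
    have key : ∀ a b : D, a ≠ b → ¬ ((a = p' ∧ b = q') ∨ (a = q' ∧ b = p')) →
        ∀ u, ψ b = ψ a ++ u → Rel ψ (N + 1) a b → Fac ψ r := by
      intro a b hab hne u hu hrel
      by_cases hu0 : u = []
      · subst hu0
        simp only [List.append_nil] at hu
        rw [comp_pr hab hu]
        apply Fac.comp
        have := totalLen_sub (ψ := ψ) b
        refine fac_one (N + 1) _ (fun d => h1 d.1) (by omega) (pr a b hab p') (pr a b hab q') ?_
          (merge hab hu hrel2) r ?_
        · unfold pr
          split <;> split <;> simp <;> grind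
        · simp [Fintype.card_subtype_compl]; omega
      · obtain ⟨c, hc, hrel'⟩ := step1 hab hu hrel
        rw [comp_tau hab hu]
        apply Fac.comp
        have := totalLen_update h1 hu
        refine ih _ (nonErasing_update h1 hu0) (by omega) c b (tau1 a b p') (tau1 a b q') hc ?_ ?_
          hrel' (step2 hab hu hrel2) r hr
        · unfold tau1; grind
        · unfold tau1; grind
    rcases hrel.prefix with ⟨u, hu⟩ | ⟨u, hu⟩
    · exact key p q hpq hne u hu hrel
    · exact key q p hpq.symm (by tauto) u hu hrel.symm

section tiling

structure Tiling {A : Type u} {B : Type v} (φ : A → List B) (y : ℤ → B) (c : ℤ → ℤ) (z : ℤ → A) :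
    Prop where
  step : ∀ i, c (i + 1) = c i + (φ (z i)).length
  val : ∀ i (j : ℕ) (hj : j < (φ (z i)).length), y (c i + j) = (φ (z i)).get ⟨j, hj⟩

theorem factor_eq {B : Type v} (y : ℤ → B) (a : ℤ) (n : ℕ) :
    factor y a n = (List.range n).map fun j : ℕ => y (a + (j : ℤ)) := by
  unfold factor
  change List.map _ (List.flatMap _ _) = _
  rw [List.map_flatMap]
  change List.flatMap (fun j : ℕ => [y (a + (j : ℤ))]) _ = _
  rw [List.map_eq_flatMap]

theorem factor_add {B : Type v} (y : ℤ → B) (a : ℤ) (m n : ℕ) :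
    factor y a (m + n) = factor y a m ++ factor y (a + m) n := by
  rw [factor_eq, factor_eq, factor_eq]
  rw [List.range_add, List.map_append, List.map_map]
  congr 1
  apply List.map_congr_left
  intro j _
  simp [add_assoc]

theorem factor_succ {B : Type v} (y : ℤ → B) (a : ℤ) (n : ℕ) :
    factor y a (n + 1) = y a :: factor y (a + 1) n := by
  rw [add_comm, factor_add]
  simp [factor_eq]

theorem factor_length {B : Type v} (y : ℤ → B) (a : ℤ) (n : ℕ) :
    (factor y a n).length = n := by
  simp [factor_eq]

theorem gap {c : ℤ → ℤ} (hc : StrictMono c) (i : ℤ) (n : ℕ) : c i + n ≤ c (i + n) := by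
  induction n with
  | zero => simp
  | succ n ih =>
    have : c (i + n) < c (i + (n + 1 : ℕ)) := hc (by push_cast; omega)
    push_cast at *; omega

theorem cover {c : ℤ → ℤ} (hc : StrictMono c) (t : ℤ) : ∃ i, c i ≤ t ∧ t < c (i + 1) := by
  obtain ⟨i, h1, h2⟩ := Int.exists_greatest_of_bdd (P := fun i => c i ≤ t)
    ⟨(t - c 0).toNat, by
      intro i hi
      by_contra h
      have := gap hc 0 i.toNat
      rw [zero_add, Int.toNat_of_nonneg (by omega)] at this
      omega⟩
    ⟨-((c 0 - t).toNat : ℤ), by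
      have := gap hc (-((c 0 - t).toNat : ℤ)) (c 0 - t).toNat
      rw [neg_add_cancel] at this
      omega⟩
  refine ⟨i, h1, ?_⟩
  by_contra h
  have := h2 (i + 1) (by omega)
  omega

variable {A : Type u} {B : Type v} {φ : A → List B} {y : ℤ → B} {c c' : ℤ → ℤ} {z z' : ℤ → A}

theorem Tiling.mono (T : Tiling φ y c z) (hφ : NonErasing φ) : StrictMono c := by
  apply strictMono_int_of_lt_succ
  intro i
  rw [T.step]
  have := List.length_pos_iff.2 (hφ (z i))
  omega

theorem Tiling.tile (T : Tiling φ y c z) (i : ℤ) :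
    φ (z i) = factor y (c i) (φ (z i)).length := by
  apply List.ext_get
  · simp [factor_eq]
  · intro n h1 h2
    rw [← T.val i n h1]
    simp [factor_eq]

theorem Tiling.factor (T : Tiling φ y c z) (i : ℤ) (n : ℕ) :
    ∃ L : ℕ, wordApply φ (factor z i n) = factor y (c i) L ∧ c (i + n) = c i + L := by
  induction n with
  | zero => exact ⟨0, by simp [factor_eq, wordApply], by simp⟩
  | succ n ih =>
    obtain ⟨L, h1, h2⟩ := ih
    refine ⟨L + (φ (z (i + n))).length, ?_, ?_⟩
    · rw [factor_add, wordApply_append, h1, factor_add, ← h2, ← T.tile]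
      congr 1
      simp [factor_eq, wordApply]
    · push_cast
      rw [← add_assoc, T.step, h2, add_assoc]

variable [Fintype A]

theorem coincide (hφ : NonErasing φ) {r : ℕ} (hr : Fintype.card A ≤ r + 1) (hF : ¬ Fac φ r)
    (T : Tiling φ y c z) (T' : Tiling φ y c' z') {i i' : ℤ} (h : c i = c' i') :
    z i = z' i' := by
  by_contra hne
  apply hF
  refine fac_one (totalLen φ) φ hφ le_rfl (z i) (z' i') hne ?_ r hr
  obtain ⟨L, h1, -⟩ := T.factor i (totalLen φ + 1)
  obtain ⟨L', h1', -⟩ := T'.factor i' (totalLen φ + 1)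
  refine ⟨Recog.factor z (i + 1) (totalLen φ), Recog.factor z' (i' + 1) (totalLen φ),
    Recog.factor y (c i + L) L', Recog.factor y (c i + L') L, by simp [factor_length],
    by simp [factor_length], ?_⟩
  rw [← factor_succ, ← factor_succ, h1, h1', ← h, ← factor_add, ← factor_add, add_comm]

theorem det (hφ : NonErasing φ) {r : ℕ} (hr : Fintype.card A ≤ r + 1) (hF : ¬ Fac φ r)
    (T : Tiling φ y c z) (T' : Tiling φ y c' z') {i i' j j' p : ℤ} (hi : c i < c' i')
    (hj : c j = c i + p) (hj' : c' j' = c' i' + p)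
    (hy : ∀ t, c i ≤ t → t < c' i' → y (t + p) = y t) :
    z i = z j := by
  by_contra hne
  apply hF
  obtain ⟨d, hd⟩ : ∃ d : ℕ, c' i' = c i + d := ⟨(c' i' - c i).toNat, by omega⟩
  have hd0 : 0 < d := by omega
  set V := factor y (c i) d with hV
  have hV2 : V = factor y (c j) d := by
    rw [hV]
    rw [factor_eq, factor_eq]
    apply List.map_congr_left
    intro s hs
    rw [List.mem_range] at hs
    rw [hj, ← hy (c i + s) (by omega) (by omega)]
    congr 1; ring
  let ψ : Option A → List B := fun o => o.elim V φ
  have hψ : NonErasing ψ := by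
    intro o
    cases o with
    | none =>
      change V ≠ []
      rw [← List.length_pos_iff, hV, factor_length]
      exact hd0
    | some a => exact hφ a
  have hsome : ∀ l, wordApply ψ (l.map some) = wordApply φ l := fun l => wordApply_map ψ some l
  have rel : ∀ k k', c' k' = c k + d → V = factor y (c k) d →
      Rel ψ (totalLen ψ) (some (z k)) none := by
    intro k k' hk hVk
    obtain ⟨L, h1, -⟩ := T.factor k (totalLen ψ + 1)
    obtain ⟨L', h1', -⟩ := T'.factor k' (totalLen ψ)
    refine ⟨(Recog.factor z (k + 1) (totalLen ψ)).map some,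
      (Recog.factor z' k' (totalLen ψ)).map some,
      Recog.factor y (c k + L) (d + L'), Recog.factor y (c k + (d + L' : ℕ)) L,
      by simp [factor_length], by simp [factor_length], ?_⟩
    rw [← List.map_cons, ← factor_succ, hsome, h1]
    change _ = (V ++ wordApply ψ (List.map some (Recog.factor z' k' (totalLen ψ)))) ++ _
    rw [hsome, h1', hVk, hk, ← factor_add, ← factor_add, ← factor_add, add_comm]
  have hfac : Fac ψ r := by
    refine fac_two (totalLen ψ) ψ hψ le_rfl (some (z i)) none (some (z j)) none (by simp) (by simp)
      ?_ (rel i i' hd hV) (rel j j' (by omega) hV2) r ?_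
    · simp [hne]
    · simp; omega
  have : φ = comp ψ (fun a => [some a]) := by
    funext a
    simp [comp, wordApply, ψ]
  rw [this]
  exact hfac.comp _

/-- matched fronts -/
def Mt (y : ℤ → B) (c c' : ℤ → ℤ) (p i i' j j' : ℤ) : Prop :=
  c j = c i + p ∧ c' j' = c' i' + p ∧
  (∀ t, min (c i) (c' i') ≤ t → t < max (c i) (c' i') → y (t + p) = y t) ∧
  (∀ a a', c a = c' a' → min (c j) (c' j') ≤ c a → max (c j) (c' j') ≤ c a)

theorem Mt.symm {p i i' j j' : ℤ} (h : Mt y c c' p i i' j j') : Mt y c' c p i' i j' j := by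
  obtain ⟨h1, h2, h3, h4⟩ := h
  refine ⟨h2, h1, ?_, ?_⟩
  · simpa only [min_comm, max_comm] using h3
  · intro a a' h
    have := h4 a' a h.symm
    rw [h, min_comm, max_comm]; exact this

theorem Mt.step (hφ : NonErasing φ) {r : ℕ} (hr : Fintype.card A ≤ r + 1) (hF : ¬ Fac φ r)
    (T : Tiling φ y c z) (T' : Tiling φ y c' z') {p i i' j j' : ℤ} (h : Mt y c c' p i i' j j')
    (hi : c i < c' i') : Mt y c c' p (i + 1) i' (j + 1) j' := by
  obtain ⟨h1, h2, h3, h4⟩ := h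
  rw [min_eq_left hi.le, max_eq_right hi.le] at h3
  rw [min_eq_left (by omega), max_eq_right (by omega)] at h4
  have hz : z i = z j := det hφ hr hF T T' hi h1 h2 h3
  have e1 := T.step i
  have e2 := T.step j
  rw [← hz] at e2
  have hlen := List.length_pos_iff.2 (hφ (z i))
  refine ⟨by omega, h2, ?_, ?_⟩
  · intro t ht1 ht2
    by_cases hlt : t < c' i'
    · exact h3 t (by omega) hlt
    · obtain ⟨k, rfl⟩ : ∃ k : ℕ, t = c i + k := ⟨(t - c i).toNat, by omega⟩
      have hk : k < (φ (z i)).length := by omega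
      have v1 := T.val i k hk
      have v2 := T.val j k (by rw [← hz]; exact hk)
      rw [v1, add_right_comm, ← h1, v2]
      simp [hz]
  · intro a a' haa ha
    by_contra hcon
    have m := T.mono hφ
    rcases le_total (c (j + 1)) (c' j') with hle | hle
    · rw [min_eq_left hle] at ha
      rw [max_eq_right hle] at hcon
      have := h4 a a' haa (by omega)
      omega
    · rw [min_eq_right hle] at ha
      rw [max_eq_left hle] at hcon
      have q1 : a < j + 1 := m.lt_iff_lt.1 (by omega)
      have q2 : j < a := m.lt_iff_lt.1 (by omega)
      omega

theorem Mt.run (hφ : NonErasing φ) {r : ℕ} (hr : Fintype.card A ≤ r + 1) (hF : ¬ Fac φ r)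
    (T : Tiling φ y c z) (T' : Tiling φ y c' z') (M : ℤ) (hM : ∀ a a', c a = c' a' → M ≤ c a)
    (p : ℤ) :
    ∀ (n : ℕ) (i i' j j' : ℤ), (M - c i).toNat + (M - c' i').toNat ≤ n →
      Mt y c c' p i i' j j' →
      (∀ t, min (c i) (c' i') ≤ t → t < M → y (t + p) = y t) ∧
      (∀ a a', c a = c' a' → min (c j) (c' j') ≤ c a → M + p ≤ c a) := by
  intro n
  induction n with
  | zero =>
    intro i i' j j' hn h
    obtain ⟨h1, h2, h3, h4⟩ := h
    exact ⟨fun t _ _ => by omega, fun a a' _ _ => by omega⟩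
  | succ n ih =>
    intro i i' j j' hn h
    by_cases hmin : M ≤ min (c i) (c' i')
    · obtain ⟨h1, h2, h3, h4⟩ := h
      exact ⟨fun t _ _ => by omega, fun a a' _ _ => by omega⟩
    · rcases lt_trichotomy (c i) (c' i') with hlt | heq | hlt
      · have h' := Mt.step hφ hr hF T T' h hlt
        obtain ⟨h1, h2, h3, h4⟩ := h
        have e := (T.mono hφ) (show i < i + 1 by omega)
        obtain ⟨g1, g2⟩ := ih (i + 1) i' (j + 1) j' (by omega) h'
        refine ⟨fun t ht1 ht2 => ?_, fun a a' haa ha => ?_⟩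
        · by_cases hh : t < c' i'
          · exact h3 t ht1 (by omega)
          · exact g1 t (by omega) ht2
        · have := h4 a a' haa ha
          exact g2 a a' haa (by omega)
      · have := hM i i' heq
        omega
      · have h' := (Mt.step hφ hr hF T' T h.symm hlt).symm
        obtain ⟨h1, h2, h3, h4⟩ := h
        have e := (T'.mono hφ) (show i' < i' + 1 by omega)
        obtain ⟨g1, g2⟩ := ih i (i' + 1) j (j' + 1) (by omega) h'
        refine ⟨fun t ht1 ht2 => ?_, fun a a' haa ha => ?_⟩
        · by_cases hh : t < c i
          · exact h3 t ht1 (by omega)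
          · exact g1 t (by omega) ht2
        · have := h4 a a' haa ha
          exact g2 a a' haa (by omega)

theorem length_le_totalLen (a : A) : (φ a).length ≤ totalLen φ :=
  Finset.single_le_sum (f := fun d => (φ d).length) (by intros; simp) (Finset.mem_univ a)

/-- if there are no coincidences far to the left, then `y` is periodic -/
theorem periodic_of_noCoin [Finite B] (hφ : NonErasing φ) {r : ℕ} (hr : Fintype.card A ≤ r + 1)
    (hF : ¬ Fac φ r)
    (T : Tiling φ y c z) (T' : Tiling φ y c' z') (M : ℤ) (hM : ∀ a a', c a = c' a' → M ≤ c a) :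
    ∃ p : ℕ, 1 ≤ p ∧ (fun n => y (n + p)) = y := by
  have m := T.mono hφ
  have m' := T'.mono hφ
  obtain ⟨i0, hi0, -⟩ := cover m M
  have hnext : ∀ i, ∃ i', c' (i' - 1) < c i ∧ c i ≤ c' i' := by
    intro i
    obtain ⟨k, h1, h2⟩ := cover m' (c i - 1)
    exact ⟨k + 1, by rw [add_sub_cancel_right]; omega, by omega⟩
  choose nx hn1 hn2 using hnext
  have hd : ∀ i, c' (nx i) - c i < totalLen φ + 1 := by
    intro i
    have e := T'.step (nx i - 1)
    rw [sub_add_cancel] at e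
    have := length_le_totalLen (φ := φ) (z' (nx i - 1))
    have := hn1 i
    omega
  let F : ℕ → Fin (totalLen φ + 1) × (Fin (totalLen φ) → B) := fun n =>
    (⟨(c' (nx (i0 - n)) - c (i0 - n)).toNat, by
      have := hd (i0 - n); have := hn2 (i0 - n); omega⟩, fun s => y (c (i0 - n) + s))
  obtain ⟨e, he⟩ := Finite.exists_infinite_fiber F
  have hS : (F ⁻¹' {e}).Infinite := Set.infinite_coe_iff.1 he
  have hpick : ∀ n : ℕ, ∃ k : ℕ, n < k ∧ F k = e := by
    intro n
    obtain ⟨k, hk, hk2⟩ := hS.exists_gt n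
    exact ⟨k, hk2, hk⟩
  -- initial matching
  have init : ∀ k l : ℕ, F k = e → F l = e →
      Mt y c c' (c (i0 - l) - c (i0 - k)) (i0 - k) (nx (i0 - k)) (i0 - l) (nx (i0 - l)) := by
    intro k l hk hl
    have hkl : F k = F l := hk.trans hl.symm
    have q1 := congrArg (fun x => (x.1 : ℕ)) hkl
    have q2 := congrArg (fun x => x.2) hkl
    simp only [F] at q1 q2
    have a1 := hn2 (i0 - k)
    have a2 := hn2 (i0 - l)
    have a3 := hd (i0 - k)
    refine ⟨by omega, by omega, ?_, ?_⟩
    · intro t h1 h2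
      rw [min_eq_left a1] at h1
      rw [max_eq_right a1] at h2
      have := congrFun q2 ⟨(t - c (i0 - k)).toNat, by omega⟩
      simp only at this
      rw [Int.toNat_of_nonneg (by omega)] at this
      rw [show c (i0 - (k : ℤ)) + (t - c (i0 - k)) = t by ring] at this
      rw [this]
      congr 1; ring
    · intro a a' haa ha
      rw [min_eq_left a2] at ha
      rw [max_eq_right a2]
      by_contra hcon
      have b1 : a' < nx (i0 - l) := m'.lt_iff_lt.1 (by omega)
      have b2 : nx (i0 - l) - 1 < a' := m'.lt_iff_lt.1 (by have := hn1 (i0 - l); omega)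
      omega
  have minL : ∀ k : ℕ, min (c (i0 - k)) (c' (nx (i0 - k))) = c (i0 - k) :=
    fun k => min_eq_left (hn2 _)
  have cle : ∀ k : ℕ, c (i0 - k) ≤ M := fun k =>
    le_trans (m.monotone (by omega)) hi0
  obtain ⟨l, -, hl⟩ := hpick 0
  obtain ⟨k, hkl, hk⟩ := hpick l
  have clt : ∀ k l : ℕ, l < k → c (i0 - k) < c (i0 - l) := fun k l h => m (by omega)
  have NC : ∀ n : ℕ, ∀ a a', c a = c' a' → M + n ≤ c a := by
    intro n
    induction n with
    | zero => simpa using hM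
    | succ n ih =>
      intro a a' haa
      have := (Mt.run hφ hr hF T T' (M + n) ih _ _ _ _ _ _ le_rfl (init k l hk hl)).2 a a' haa
        (by rw [minL]; have := ih a a' haa; have := cle l; omega)
      have := clt k l hkl
      push_cast; omega
  have per : ∀ k l : ℕ, l < k → F k = e → F l = e → ∀ t, c (i0 - k) ≤ t →
      y (t + (c (i0 - l) - c (i0 - k))) = y t := by
    intro k l hkl hk hl t ht
    refine (Mt.run hφ hr hF T T' (M + (t + 1 - M).toNat) (NC _) _ _ _ _ _ _ le_rfl
      (init k l hk hl)).1 t (by rw [minL]; exact ht) (by omega)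
  have hp := clt k l hkl
  refine ⟨(c (i0 - l) - c (i0 - k)).toNat, by omega, ?_⟩
  funext t
  rw [Int.toNat_of_nonneg (by omega)]
  obtain ⟨q, hq, hqe⟩ := hpick (k + (c (i0 - k) - t).toNat)
  have hkq : k < q := by omega
  have hqt : c (i0 - q) ≤ t := by
    have := gap m (i0 - q) (q - k)
    rw [show i0 - (q : ℤ) + ((q - k : ℕ) : ℤ) = i0 - k by omega] at this
    omega
  have P := per q k hkq hqe hk
  have P' := per k l hkl hk hl
  have s1 := P t hqt
  have := clt q k hkq
  have s2 := P' (t + (c (i0 - k) - c (i0 - q))) (by omega)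
  have s3 := P (t + (c (i0 - l) - c (i0 - k))) (by omega)
  rw [← s3, ← s1, ← s2]
  congr 1; ring

theorem recognizable [Finite B] (hφ : NonErasing φ) {r : ℕ} (hr : Fintype.card A ≤ r + 1)
    (hF : ¬ Fac φ r) (hy : Aperiodic y)
    (T : Tiling φ y c z) (T' : Tiling φ y c' z') :
    ∃ s, ∀ i, c' (i + s) = c i ∧ z' (i + s) = z i := by
  have m := T.mono hφ
  have m' := T'.mono hφ
  have hun : ∀ M, ∃ a a', c a = c' a' ∧ c a < M := by
    by_contra hcon
    push Not at hcon
    obtain ⟨M, hM⟩ := hcon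
    obtain ⟨p, hp, hpy⟩ := periodic_of_noCoin hφ hr hF T T' M hM
    exact hy p hp hpy
  have fwd : ∀ a a', c a = c' a' → ∀ n : ℕ, c' (a' + n) = c (a + n) ∧ z' (a' + n) = z (a + n) := by
    intro a a' h n
    induction n with
    | zero =>
      simp [h, coincide hφ hr hF T T' h]
    | succ n ih =>
      have h1 : c (a + (n + 1 : ℕ)) = c' (a' + (n + 1 : ℕ)) := by
        push_cast
        rw [← add_assoc, ← add_assoc, T.step, T'.step, ih.1, ih.2]
      exact ⟨h1.symm, (coincide hφ hr hF T T' h1).symm⟩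
  obtain ⟨a0, a0', h0, -⟩ := hun 0
  refine ⟨a0' - a0, fun i => ?_⟩
  obtain ⟨a, a', h, hlt⟩ := hun (min (c i) (c a0))
  have l1 : a < i := m.lt_iff_lt.1 (by omega)
  have l2 : a < a0 := m.lt_iff_lt.1 (by omega)
  have f0 := (fwd a a' h (a0 - a).toNat).1
  rw [Int.toNat_of_nonneg (by omega), add_sub_cancel, h0] at f0
  have := m'.injective f0
  have fi := fwd a a' h (i - a).toNat
  rw [Int.toNat_of_nonneg (by omega), add_sub_cancel] at fi
  rw [show i + (a0' - a0) = a' + (i - a) by omega]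
  exact fi

end tiling

section compactness
variable {C : Type u} {A : Type v}

abbrev Cell (α : C → List A) := Σ c : C, Fin (α c).length

def out (α : C → List A) (e : Cell α) : A := (α e.1).get e.2

def cells (α : C → List A) (c : C) : List (Cell α) :=
  (List.finRange (α c).length).map fun j => ⟨c, j⟩

def RR (α : C → List A) (e e' : Cell α) : Prop :=
  (e.2.val + 1 < (α e.1).length ∧ e'.1 = e.1 ∧ e'.2.val = e.2.val + 1) ∨
  (e.2.val + 1 = (α e.1).length ∧ e'.2.val = 0)

theorem cells_length (α : C → List A) (c : C) : (cells α c).length = (α c).length := by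
  simp [cells]

theorem cells_get (α : C → List A) (c : C) (i : ℕ) (hi : i < (cells α c).length) :
    (cells α c)[i] = ⟨c, ⟨i, by simpa [cells] using hi⟩⟩ := by
  simp [cells]

theorem map_out (α : C → List A) (w : List C) :
    (wordApply (cells α) w).map (out α) = wordApply α w := by
  induction w with
  | nil => rfl
  | cons c w ih =>
    simp only [wordApply, List.map_append, ih]
    congr 1
    apply List.ext_get
    · simp [cells]
    · intro n h1 h2
      simp [cells, out]

theorem head_cells (α : C → List A) (hα : NonErasing α) (w : List C) :
    ∀ e ∈ (wordApply (cells α) w).head?, e.2.val = 0 := by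
  cases w with
  | nil => simp [wordApply]
  | cons c w =>
    intro e he
    have h : (cells α c) ≠ [] := by
      have := hα c
      simpa [cells] using this
    rw [wordApply, List.head?_append_of_ne_nil _ h, List.head?_eq_getElem?] at he
    simp only [Option.mem_def, List.getElem?_eq_some_iff] at he
    obtain ⟨h1, h2⟩ := he
    rw [← h2, cells_get]

theorem chain_cells (α : C → List A) (hα : NonErasing α) (w : List C) :
    (wordApply (cells α) w).IsChain (RR α) := by
  induction w with
  | nil => exact List.IsChain.nil
  | cons c w ih =>
    rw [wordApply, List.isChain_append]
    refine ⟨?_, ih, ?_⟩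
    · rw [List.isChain_iff_getElem]
      intro i hi
      left
      rw [cells_length] at hi
      rw [cells_get, cells_get]
      exact ⟨hi, rfl, rfl⟩
    · intro e he e' he'
      right
      refine ⟨?_, head_cells α hα w e' he'⟩
      rw [List.getLast?_eq_getElem?] at he
      simp only [Option.mem_def, List.getElem?_eq_some_iff] at he
      obtain ⟨h1, h2⟩ := he
      rw [← h2, cells_get]
      change (cells α c).length - 1 + 1 = (α c).length
      rw [cells_length] at h1 ⊢
      omega

theorem exists_config [Finite C] (α : C → List A) (hα : NonErasing α) (x : ℤ → A)
    (hx : ∀ N : ℕ, ∃ N' ≥ N, ∃ w, factor x (-(N' : ℤ)) (2 * N' + 2) <:+: wordApply α w) :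
    ∃ f : ℤ → Cell α, ∀ t, out α (f t) = x t ∧ RR α (f t) (f (t + 1)) := by
  have h1 : ∀ N : ℕ, ∃ f : ℤ → Cell α, ∀ t, -(N : ℤ) ≤ t → t ≤ N →
      out α (f t) = x t ∧ RR α (f t) (f (t + 1)) := by
    intro N
    obtain ⟨M, hM, w, s, s', hw⟩ := hx N
    set G := wordApply (cells α) w with hG
    have hGo : G.map (out α) = s ++ factor x (-(M : ℤ)) (2 * M + 2) ++ s' := by
      rw [hw, hG, map_out]
    have hlen : s.length + (2 * M + 2) + s'.length = G.length := by
      have := congrArg List.length hGo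
      simp [factor_length] at this
      omega
    have hch := chain_cells α hα w
    rw [← hG, List.isChain_iff_getElem] at hch
    have hpos : 0 < G.length := by omega
    refine ⟨fun t => G.getD (s.length + (t + M).toNat) (G[0]), fun t ht1 ht2 => ⟨?_, ?_⟩⟩
    · have hlt : s.length + (t + M).toNat < G.length := by omega
      beta_reduce
      rw [List.getD_eq_getElem _ _ hlt]
      have e : out α G[s.length + (t + M).toNat]
          = (G.map (out α))[s.length + (t + M).toNat]'(by simpa using hlt) := by simp
      rw [e]
      simp only [hGo]
      rw [List.getElem_append_left (by simp [factor_length]; omega),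
        List.getElem_append_right (by omega)]
      simp only [factor_eq, List.getElem_map, List.getElem_range]
      congr 1; omega
    · have hlt : s.length + (t + M).toNat + 1 < G.length := by omega
      have := hch _ hlt
      beta_reduce
      rw [List.getD_eq_getElem _ _ (by omega), List.getD_eq_getElem _ _ (by omega)]
      convert this using 2
      omega
  choose F hF using h1
  have h2 : ∀ t : ℤ, ∃ e, ∀ᶠ N in (Filter.hyperfilter ℕ : Filter ℕ), F N t = e := by
    intro t
    obtain ⟨e, he⟩ := Ultrafilter.eq_pure_of_finite ((Filter.hyperfilter ℕ).map fun N => F N t)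
    refine ⟨e, ?_⟩
    have : {e} ∈ (Filter.hyperfilter ℕ).map fun N => F N t := by
      rw [he]; exact Set.mem_singleton e
    exact this
  choose f hf using h2
  refine ⟨f, fun t => ?_⟩
  have hlarge : ∀ᶠ N in (Filter.hyperfilter ℕ : Filter ℕ), t.natAbs ≤ N := by
    have := (Filter.eventually_ge_atTop t.natAbs)
    rw [← Nat.cofinite_eq_atTop] at this
    exact Filter.hyperfilter_le_cofinite this
  obtain ⟨N, ⟨h3, h4⟩, h5⟩ := ((hf t).and (hf (t + 1)) |>.and hlarge).exists
  have := hF N t (by omega) (by omega)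
  rw [h3, h4] at this
  exact this

theorem exists_tiling [Finite C] (α : C → List A) (hα : NonErasing α) (x : ℤ → A)
    (hx : ∀ N : ℕ, ∃ N' ≥ N, ∃ w, factor x (-(N' : ℤ)) (2 * N' + 2) <:+: wordApply α w) :
    ∃ d z, Tiling α x d z := by
  obtain ⟨f, hf⟩ := exists_config α hα x hx
  have tile : ∀ t, (f t).2.val = 0 → ∀ j : ℕ, j < (α (f t).1).length →
      (f (t + j)).1 = (f t).1 ∧ (f (t + j)).2.val = j := by
    intro t ht j
    induction j with
    | zero => intro _; rw [Nat.cast_zero, add_zero]; exact ⟨rfl, ht⟩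
    | succ j ih =>
      intro hj
      obtain ⟨h1, h2⟩ := ih (by omega)
      push_cast
      rw [← add_assoc]
      rcases (hf (t + j)).2 with ⟨_, h4, h5⟩ | ⟨h3, _⟩
      · exact ⟨h4.trans h1, by omega⟩
      · have := congrArg (fun c => (α c).length) h1
        omega
  have back : ∀ (n : ℕ) s, (f s).2.val = n → (f (s - n)).2.val = 0 ∧ (f (s - n)).1 = (f s).1 := by
    intro n
    induction n with
    | zero => intro s hs; rw [Nat.cast_zero, sub_zero]; exact ⟨hs, rfl⟩
    | succ n ih =>
      intro s hs
      have h := (hf (s - 1)).2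
      rw [sub_add_cancel] at h
      rcases h with ⟨_, h4, h5⟩ | ⟨_, h3⟩
      · obtain ⟨g1, g2⟩ := ih (s - 1) (by omega)
        rw [show s - ((n + 1 : ℕ) : ℤ) = s - 1 - n by push_cast; ring]
        exact ⟨g1, g2.trans h4.symm⟩
      · omega
  have hlen : ∀ c, 0 < (α c).length := fun c => List.length_pos_iff.2 (hα c)
  have last : ∀ t, (f t).2.val = 0 → (f (t + (α (f t).1).length - 1)).1 = (f t).1 ∧
      (f (t + (α (f t).1).length - 1)).2.val + 1 = (α (f t).1).length := by
    intro t ht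
    have hl := hlen (f t).1
    have := tile t ht ((α (f t).1).length - 1) (by omega)
    rw [Nat.cast_sub hl, Nat.cast_one, ← add_sub_assoc] at this
    exact ⟨this.1, by omega⟩
  let P := {t : ℤ // (f t).2.val = 0}
  let nx : P → P := fun t => ⟨t.1 + (α (f t.1).1).length, by
    obtain ⟨h1, h2⟩ := last t.1 t.2
    have h := (hf (t.1 + (α (f t.1).1).length - 1)).2
    rw [sub_add_cancel] at h
    rcases h with ⟨h3, _⟩ | ⟨_, h3⟩
    · have := congrArg (fun c => (α c).length) h1
      omega
    · exact h3⟩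
  have hbij : Function.Bijective nx := by
    constructor
    · intro t t' h
      have h' : t.1 + ((α (f t.1).1).length : ℤ) = t'.1 + (α (f t'.1).1).length :=
        congrArg Subtype.val h
      obtain ⟨h1, -⟩ := last t.1 t.2
      obtain ⟨h2, -⟩ := last t'.1 t'.2
      rw [h', h2] at h1
      rw [h1] at h'
      exact Subtype.ext (by omega)
    · intro s
      obtain ⟨g1, g2⟩ := back _ (s.1 - 1) rfl
      refine ⟨⟨_, g1⟩, Subtype.ext ?_⟩
      change s.1 - 1 - ((f (s.1 - 1)).2.val : ℤ) + ((α (f (s.1 - 1 - ((f (s.1 - 1)).2.val : ℤ))).1).length : ℤ) = s.1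
      rw [g2]
      have h := (hf (s.1 - 1)).2
      rw [sub_add_cancel] at h
      rcases h with ⟨_, _, h3⟩ | ⟨h3, _⟩
      · have := s.2; omega
      · omega
  let e : Equiv.Perm P := Equiv.ofBijective nx hbij
  let p0 : P := ⟨_, (back _ 0 rfl).1⟩
  refine ⟨fun i => ((e ^ i) p0).1, fun i => (f ((e ^ i) p0).1).1, ?_, ?_⟩
  · intro i
    change ((e ^ (i + 1)) p0).1 = _
    rw [add_comm, zpow_one_add]
    rfl
  · intro i j hj
    obtain ⟨h1, h2⟩ := tile _ ((e ^ i) p0).2 j hj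
    rw [← (hf _).1]
    have aux : ∀ (q : Cell α) (c : C) (hj : j < (α c).length), q.1 = c → q.2.val = j →
        out α q = (α c).get ⟨j, hj⟩ := by
      rintro ⟨q1, q2⟩ c hj rfl rfl
      rfl
    exact aux _ _ _ h1 h2

end compactness

section compose
variable {A : Type u} {B : Type v} {C : Type u}

theorem Tiling.comp {σ : A → List B} {α : C → List A} {y : ℤ → B} {x : ℤ → A} {z : ℤ → C}
    {c d : ℤ → ℤ} (T : Tiling σ y c x) (S : Tiling α x d z) :
    Tiling (Recog.comp σ α) y (fun i => c (d i)) z := by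
  have key : ∀ i, ∃ L : ℕ, Recog.comp σ α (z i) = Recog.factor y (c (d i)) L ∧
      c (d (i + 1)) = c (d i) + L := by
    intro i
    obtain ⟨L, h1, h2⟩ := T.factor (d i) (α (z i)).length
    refine ⟨L, ?_, ?_⟩
    · rw [← h1, ← S.tile]; rfl
    · rw [S.step, h2]
  constructor
  · intro i
    obtain ⟨L, h1, h2⟩ := key i
    rw [h2, h1, factor_length]
  · intro i j hj
    obtain ⟨L, h1, h2⟩ := key i
    simp [h1, factor_eq]

theorem cut_succ (σ : A → List B) (x : ℤ → A) (ℓ : ℤ) :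
    cut σ x (ℓ + 1) = cut σ x ℓ + (σ (x ℓ)).length := by
  unfold cut
  by_cases h : 0 ≤ ℓ
  · rw [if_pos h, if_pos (by omega), Int.toNat_add h (by omega)]
    simp [Finset.sum_range_succ, Int.toNat_of_nonneg h, max_eq_left h]
  · rw [if_neg h]
    obtain ⟨n, rfl⟩ : ∃ n : ℕ, ℓ = -(n : ℤ) - 1 := ⟨(-ℓ - 1).toNat, by omega⟩
    have e1 : (-(-(n : ℤ) - 1)).toNat = n + 1 := by omega
    rw [e1, Finset.sum_range_succ]
    by_cases hn : n = 0
    · subst hn; simp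
    · rw [if_neg (by omega)]
      have e2 : (-(-(n : ℤ) - 1 + 1)).toNat = n := by omega
      rw [e2]; ring

theorem cut_zero (σ : A → List B) (x : ℤ → A) : cut σ x 0 = 0 := by simp [cut]

theorem tiling_of_rep {σ : A → List B} {y : ℤ → B} {k : ℤ} {x : ℤ → A} (h : IsRep σ y k x) :
    Tiling σ y (fun ℓ => cut σ x ℓ - k) x := by
  constructor
  · intro i
    simp only [cut_succ]; ring
  · intro i j hj
    rw [← h i j hj]
    simp only
    congr 1; ring

theorem comp_nonErasing {σ : A → List B} {α : C → List A} (hσ : NonErasing σ)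
    (hα : NonErasing α) : NonErasing (Recog.comp σ α) :=
  fun c => wordApply_ne_nil σ hσ _ (hα c)

/-- the final uniqueness argument -/
theorem unique_rep [Fintype C] [Finite B] {σ : A → List B} {α : C → List A} (hσ : NonErasing σ)
    (hα : NonErasing α) {r : ℕ} (hr : Fintype.card C ≤ r + 1) (hF : ¬ Fac (Recog.comp σ α) r)
    {y : ℤ → B} (hy : Aperiodic y) {k k' : ℤ} {x x' : ℤ → A} {d d' : ℤ → ℤ} {z z' : ℤ → C}
    (S : Tiling α x d z) (S' : Tiling α x' d' z')
    (h : IsCenteredRep σ y k x) (h' : IsCenteredRep σ y k' x') : k = k' ∧ x = x' := by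
  obtain ⟨hrep, hk0, hk1⟩ := h
  obtain ⟨hrep', hk0', hk1'⟩ := h'
  have T := tiling_of_rep hrep
  have T' := tiling_of_rep hrep'
  obtain ⟨s, hs⟩ := recognizable (comp_nonErasing hσ hα) hr hF hy (T.comp S) (T'.comp S')
  set c := fun ℓ => cut σ x ℓ - k with hc
  set c' := fun ℓ => cut σ x' ℓ - k' with hc'
  have hdS : ∀ i, d' (i + s) - d i = d' s - d 0 := by
    intro i
    have st : ∀ i, d' (i + 1 + s) - d (i + 1) = d' (i + s) - d i := by
      intro i
      rw [add_right_comm, S.step, S'.step, (hs i).2]; ring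
    induction i using Int.induction_on with
    | zero => simp
    | succ i ih => rw [st, ih]
    | pred i ih => rw [← ih, ← st (-(i : ℤ) - 1), sub_add_cancel]
  set Q := d' s - d 0 with hQ
  have hxx : ∀ t, x' (t + Q) = x t := by
    intro t
    obtain ⟨i, h1, h2⟩ := cover (S.mono hα) t
    rw [S.step] at h2
    obtain ⟨j, rfl⟩ : ∃ j : ℕ, t = d i + j := ⟨(t - d i).toNat, by omega⟩
    have hj : j < (α (z i)).length := by omega
    have v1 := S.val i j hj
    have v2 := S'.val (i + s) j (by rw [(hs i).2]; exact hj)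
    rw [v1, show d i + (j : ℤ) + Q = d' (i + s) + j by have := hdS i; omega, v2]
    simp [(hs i).2]
  have hcc : ∀ t, c' (t + Q) = c t := by
    have st : ∀ t, c' (t + 1 + Q) - c (t + 1) = c' (t + Q) - c t := by
      intro t
      rw [add_right_comm, T.step, T'.step, hxx]; ring
    have h0 : c' (d 0 + Q) - c (d 0) = 0 := by
      have := (hs 0).1
      rw [zero_add] at this
      have this2 : c' (d' s) = c (d 0) := this
      rw [show d 0 + Q = d' s by omega, this2, sub_self]
    have all : ∀ t, c' (d 0 + t + Q) - c (d 0 + t) = 0 := by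
      intro t
      induction t using Int.induction_on with
      | zero => simpa using h0
      | succ i ih => rw [← add_assoc, st, ih]
      | pred i ih =>
        have e := st (d 0 + (-(i : ℤ) - 1))
        rw [show d 0 + (-(i : ℤ) - 1) + 1 = d 0 + -(i : ℤ) by ring] at e
        rw [← e]
        exact ih
    intro t
    have := all (t - d 0)
    rw [add_sub_cancel] at this
    omega
  have c0 : c 0 = -k := by simp [hc, cut_zero]
  have c0' : c' 0 = -k' := by simp [hc', cut_zero]
  have c1 := T.step 0
  have c1' := T'.step 0
  have m' := T'.mono hσ
  have q0 := hcc 0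
  have q1 := hcc (0 + 1)
  have i1 : Q < 0 + 1 := m'.lt_iff_lt.1 (by rw [zero_add] at q0; omega)
  have i2 : 0 < 0 + 1 + Q := m'.lt_iff_lt.1 (by omega)
  have hQ0 : Q = 0 := by omega
  rw [hQ0] at hxx q0
  refine ⟨by rw [add_zero] at q0; omega, ?_⟩
  funext t
  have := hxx t
  rw [add_zero] at this
  exact this.symm

end compose

section final
variable {𝒜 : ℕ → Type u}

theorem wordApply_hcongr {p q m : ℕ} (h : p = q) (f : 𝒜 p → List (𝒜 m)) (g : 𝒜 q → List (𝒜 m))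
    (hfg : ∀ a a', HEq a a' → f a = g a') (s : List (𝒜 p)) (s' : List (𝒜 q)) (hs : HEq s s') :
    wordApply f s = wordApply g s' := by
  subst h
  obtain rfl := eq_of_heq hs
  have : f = g := funext fun a => hfg a a HEq.rfl
  rw [this]

theorem sigma_heq (σ : ∀ n, 𝒜 (n + 1) → List (𝒜 n)) {p q : ℕ} (h : p = q) (a : 𝒜 (p + 1))
    (a' : 𝒜 (q + 1)) (ha : HEq a a') : HEq (σ p a) (σ q a') := by
  subst h
  obtain rfl := eq_of_heq ha
  rfl

theorem blockFrom_succ (σ : ∀ n, 𝒜 (n + 1) → List (𝒜 n)) (n k : ℕ) (a : 𝒜 (n + k + 1)) :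
    blockFrom σ n (k + 1) a = wordApply (blockFrom σ n k) (σ (n + k) a) := rfl

theorem blockFrom_nonErasing (σ : ∀ n, 𝒜 (n + 1) → List (𝒜 n)) (hσ : ∀ n, NonErasing (σ n))
    (n k : ℕ) : NonErasing (blockFrom σ n k) := by
  induction k with
  | zero => intro a; exact List.cons_ne_nil _ _
  | succ k ih =>
    intro a
    exact wordApply_ne_nil _ ih _ (hσ (n + k) a)

theorem left_unroll (σ : ∀ n, 𝒜 (n + 1) → List (𝒜 n)) (n k : ℕ) :
    ∀ (a : 𝒜 (n + (k + 1))) (a' : 𝒜 (n + 1 + k)), HEq a a' →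
      blockFrom σ n (k + 1) a = wordApply (σ n) (blockFrom σ (n + 1) k a') := by
  induction k with
  | zero =>
    intro a a' h
    obtain rfl := eq_of_heq h
    have h1 : blockFrom σ n (0 + 1) a = wordApply (fun b => [b]) (σ n a) := rfl
    have h2 : ∀ s : List (𝒜 n), wordApply (fun b => [b]) s = s := by
      intro s
      induction s with
      | nil => rfl
      | cons b s ih => simp [wordApply, ih]
    have h3 : wordApply (σ n) (blockFrom σ (n + 1) 0 a) = wordApply (σ n) [a] := rfl
    rw [h1, h2, h3, wordApply_singleton]
  | succ k ih =>
    intro a a' h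
    have h3 : wordApply (σ n) (blockFrom σ (n + 1) (k + 1) a') =
      wordApply (Recog.comp (σ n) (blockFrom σ (n + 1) k)) (σ (n + 1 + k) a') :=
        (wordApply_comp _ _ _).symm
    rw [h3]
    exact wordApply_hcongr (show n + (k + 1) = n + 1 + k by omega) (blockFrom σ n (k + 1)) _ ih _ _
      (sigma_heq σ (show n + (k + 1) = n + 1 + k by omega) a a' h)

/-- blocks factor through a small alphabet -/
def GoodBy (σ : ∀ n, 𝒜 (n + 1) → List (𝒜 n)) (n : ℕ) {E : Type u} (α : E → List (𝒜 n)) (k : ℕ) :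
    Prop := ∀ a : 𝒜 (n + k), ∃ w, blockFrom σ n k a = wordApply α w

def Good (σ : ∀ n, 𝒜 (n + 1) → List (𝒜 n)) (n r : ℕ) : Prop :=
  ∃ (E : Type u) (_ : Fintype E) (α : E → List (𝒜 n)) (k : ℕ),
    Fintype.card E ≤ r ∧ NonErasing α ∧ GoodBy σ n α k

theorem good_card [∀ n, Fintype (𝒜 n)] (σ : ∀ n, 𝒜 (n + 1) → List (𝒜 n))
    (hσ : ∀ n, NonErasing (σ n)) (n k : ℕ) : Good σ n (Fintype.card (𝒜 (n + k))) :=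
  ⟨𝒜 (n + k), inferInstance, blockFrom σ n k, k, le_rfl, blockFrom_nonErasing σ hσ n k,
    fun a => ⟨[a], (wordApply_singleton _ _).symm⟩⟩

theorem good_fac (σ : ∀ n, 𝒜 (n + 1) → List (𝒜 n)) {n r k : ℕ} {E : Type u}
    {α : E → List (𝒜 (n + 1))} (hg : GoodBy σ (n + 1) α k) (hF : Fac (Recog.comp (σ n) α) r) :
    Good σ n r := by
  obtain ⟨E', i, α', β, h1, h2, h3⟩ := hF
  refine ⟨E', i, α', k + 1, h1, h2, ?_⟩
  intro a
  have hT : 𝒜 (n + (k + 1)) = 𝒜 (n + 1 + k) := by congr 1; omega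
  obtain ⟨w, hw⟩ := hg (cast hT a)
  refine ⟨wordApply β w, ?_⟩
  rw [left_unroll σ n k a (cast hT a) (cast_heq _ _).symm, hw, ← wordApply_comp, h3,
    wordApply_comp]

theorem good_pred (σ : ∀ n, 𝒜 (n + 1) → List (𝒜 n)) (hσ : ∀ n, NonErasing (σ n)) {n r : ℕ}
    (h : Good σ (n + 1) r) : Good σ n r := by
  obtain ⟨E, i, α, k, h1, h2, h3⟩ := h
  refine good_fac σ h3 ⟨E, i, Recog.comp (σ n) α, fun e => [e], h1,
    comp_nonErasing (hσ n) h2, ?_⟩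
  funext e
  exact (wordApply_singleton _ _).symm

theorem range_wordApply {D E B : Type*} (f : D → List B) (α : E → List B)
    (h : ∀ d, ∃ w, f d = wordApply α w) (s : List D) : ∃ w, wordApply f s = wordApply α w := by
  induction s with
  | nil => exact ⟨[], rfl⟩
  | cons a s ih =>
    obtain ⟨w, hw⟩ := ih
    obtain ⟨w', hw'⟩ := h a
    exact ⟨w' ++ w, by rw [wordApply_append, ← hw, ← hw']; rfl⟩

theorem GoodBy.mono {σ : ∀ n, 𝒜 (n + 1) → List (𝒜 n)} {n k : ℕ} {E : Type u}
    {α : E → List (𝒜 n)} (hg : GoodBy σ n α k) {k' : ℕ} (hk : k ≤ k') : GoodBy σ n α k' := by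
  induction k', hk using Nat.le_induction with
  | base => exact hg
  | succ j _ ih => intro a; exact range_wordApply _ _ ih _

theorem tiling_of_mem [∀ n, Fintype (𝒜 n)] {σ : ∀ n, 𝒜 (n + 1) → List (𝒜 n)} {n k : ℕ}
    {E : Type u} [Fintype E] {α : E → List (𝒜 n)} (hα : NonErasing α) (hg : GoodBy σ n α k)
    {x : ℤ → 𝒜 n} (hx : x ∈ sadicX σ n) : ∃ d z, Tiling α x d z := by
  apply exists_tiling α hα x
  intro N
  have hb : ∃ b, ∀ j < k, ∀ a : 𝒜 (n + j), (blockFrom σ n j a).length ≤ b := by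
    refine ⟨∑ j ∈ Finset.range k, ∑ a, (blockFrom σ n j a).length, ?_⟩
    intro j hj a
    refine le_trans ?_ (Finset.single_le_sum
      (f := fun j => ∑ a, (blockFrom σ n j a).length) (fun _ _ => Nat.zero_le _)
      (Finset.mem_range.2 hj))
    exact Finset.single_le_sum (f := fun a => (blockFrom σ n j a).length)
      (fun _ _ => Nat.zero_le _) (Finset.mem_univ a)
  obtain ⟨b, hb⟩ := hb
  refine ⟨max N b, le_max_left _ _, ?_⟩
  obtain ⟨j, a, _, hj⟩ := hx _ ⟨-((max N b : ℕ) : ℤ), 2 * max N b + 2, rfl⟩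
  by_cases hk : k ≤ j
  · obtain ⟨w, hw⟩ := hg.mono hk a
    exact ⟨w, hw ▸ hj⟩
  · exfalso
    have h1 := hb j (by omega) a
    have h2 := hj.length_le
    rw [factor_length] at h2
    have := le_max_right N b
    omega

theorem main_aux [∀ n, Fintype (𝒜 n)] (σ : ∀ n, 𝒜 (n + 1) → List (𝒜 n))
    (hσ : ∀ n, NonErasing (σ n)) (K : ℕ) (hK : ∀ n, ∃ m ≥ n, Fintype.card (𝒜 m) ≤ K) :
    ∃ n₀ : ℕ, ∀ n ≥ n₀, RecInAp (σ n) (sadicX σ (n + 1)) := by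
  classical
  have hex : ∀ n, ∃ r, Good σ n r := fun n => ⟨_, good_card σ hσ n 0⟩
  let R : ℕ → ℕ := fun n => Nat.find (hex n)
  have hR : ∀ n, Good σ n (R n) := fun n => Nat.find_spec (hex n)
  have hRmin : ∀ n r, Good σ n r → R n ≤ r := fun n r h => Nat.find_min' (hex n) h
  have hmono : Monotone R := monotone_nat_of_le_succ fun n => hRmin n _ (good_pred σ hσ (hR (n + 1)))
  have hbd : ∀ n, R n ≤ K := by
    intro n
    obtain ⟨m, hm, hc⟩ := hK n
    obtain ⟨k, rfl⟩ := Nat.exists_eq_add_of_le hm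
    exact (hRmin n _ (good_card σ hσ n k)).trans hc
  obtain ⟨n₀, hn₀⟩ : ∃ n₀, ∀ n ≥ n₀, R n = R n₀ := by
    have hfin : (Set.range R).Finite := (Set.finite_Iic K).subset (by
      rintro _ ⟨n, rfl⟩; exact hbd n)
    obtain ⟨_, ⟨n₀, rfl⟩, hmax⟩ := hfin.exists_maximal (Set.range_nonempty R)
    exact ⟨n₀, fun n hn => le_antisymm (hmax ⟨n, rfl⟩ (hmono hn)) (hmono hn)⟩
  refine ⟨n₀, fun n hn => ?_⟩
  intro y hy k k' x x' hx hx' hr hr'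
  obtain ⟨E, _, α, j, hcard, hα, hg⟩ := hR (n + 1)
  have hRR : R (n + 1) = R n := by rw [hn₀ n hn, hn₀ (n + 1) (by omega)]
  obtain ⟨d, z, S⟩ := tiling_of_mem hα hg hx
  obtain ⟨d', z', S'⟩ := tiling_of_mem hα hg hx'
  have hpos : 0 < Fintype.card E := Fintype.card_pos_iff.2 ⟨z 0⟩
  refine unique_rep (r := R (n + 1) - 1) (hσ n) hα (by omega) ?_ hy S S' hr hr'
  intro hF
  have := hRmin n _ (good_fac σ hg hF)
  omega

theorem bound_of_liminf (f : ℕ → ℕ)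
    (h : Filter.liminf (fun n => (f n : ℕ∞)) Filter.atTop < ⊤) :
    ∃ K, ∀ n, ∃ m ≥ n, f m ≤ K := by
  obtain ⟨K, hK⟩ := ENat.ne_top_iff_exists.1 h.ne
  refine ⟨K, fun n => ?_⟩
  by_contra hc
  push Not at hc
  have : ((K + 1 : ℕ) : ℕ∞) ≤ Filter.liminf (fun n => (f n : ℕ∞)) Filter.atTop := by
    apply Filter.le_liminf_of_le (by isBoundedDefault)
    filter_upwards [Filter.eventually_ge_atTop n] with m hm
    exact_mod_cast hc m hm
  rw [← hK] at this
  have := Nat.cast_le.1 this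
  omega

end final
end RecogAux

open Recog in
/-- An everywhere growing directive sequence with `liminf |𝒜_n| < ∞` is
eventually recognizable for aperiodic points. -/
theorem stmt3 {𝒜 : ℕ → Type*} [∀ n, Fintype (𝒜 n)]
    (σ : ∀ n, 𝒜 (n + 1) → List (𝒜 n)) (hσ : ∀ n, NonErasing (σ n))
    (hgrow : EverywhereGrowing σ)
    (hliminf : Filter.liminf (fun n => (Fintype.card (𝒜 n) : ℕ∞)) Filter.atTop < ⊤) :
    ∃ n₀ : ℕ, ∀ n ≥ n₀, RecInAp (σ n) (sadicX σ (n + 1)) := by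
  obtain ⟨K, hK⟩ := RecogAux.bound_of_liminf _ hliminf
  exact RecogAux.main_aux σ hσ K hK
end

section
/- Let σ: 𝒜 → 𝒜⁺ be a (non-erasing) substitution on a finite alphabet 𝒜. Then σ is recognizable in X_σ for aperiodic points: every aperiodic point y ∈ 𝒜^ℤ has at most one centered σ-representation (k,x) with x ∈ X_σ. -/
open scoped BigOperators

namespace Recog

variable {A B C D : Type*}

theorem wordApply_append (σ : A → List B) (u v : List A) :
    wordApply σ (u ++ v) = wordApply σ u ++ wordApply σ v := by
  induction u with
  | nil => simp [wordApply]
  | cons a u ih => simp [wordApply, ih]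

theorem wordApply_comp (τ : B → List C) (σ : A → List B) (u : List A) :
    wordApply τ (wordApply σ u) = wordApply (fun a => wordApply τ (σ a)) u := by
  induction u with
  | nil => simp [wordApply]
  | cons a u ih => simp [wordApply, wordApply_append, ih]

theorem wordApply_congr {σ τ : A → List B} (h : ∀ a, σ a = τ a) (u : List A) :
    wordApply σ u = wordApply τ u := by
  have : σ = τ := funext h
  rw [this]

theorem length_le_wordApply {σ : A → List B} (h : NonErasing σ) (u : List A) :
    u.length ≤ (wordApply σ u).length := by
  induction u with
  | nil => simp
  | cons a u ih =>
    have := List.length_pos_of_ne_nil (h a)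
    simp [wordApply]; omega

theorem wordApply_single (u : List A) : wordApply (fun a => [a]) u = u := by
  induction u with
  | nil => rfl
  | cons a u ih => simp [wordApply, ih]

/-- factorization through `r` letters -/
def Fac (σ : A → List B) (r : ℕ) : Prop :=
  ∃ (β : A → List (Fin r)) (α : Fin r → List B), NonErasing α ∧
    ∀ a, σ a = wordApply α (β a)

theorem Fac.precomp {τ : B → List C} {r : ℕ} (h : Fac τ r) (θ : A → List B) {σ : A → List C}
    (e : ∀ a, σ a = wordApply τ (θ a)) : Fac σ r := by
  obtain ⟨β, α, ha, hb⟩ := h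
  refine ⟨fun a => wordApply β (θ a), α, ha, fun a => ?_⟩
  rw [e, wordApply_comp]
  exact wordApply_congr hb _

theorem fac_card [Fintype A] (σ : A → List B) (h : NonErasing σ) : Fac σ (Fintype.card A) := by
  refine ⟨fun a => [Fintype.equivFin A a], fun i => σ ((Fintype.equivFin A).symm i),
    fun i => h _, fun a => by simp [wordApply]⟩

def Compat (u v : List B) : Prop := ∃ Y, u <+: Y ∧ v <+: Y

theorem Compat.symm {u v : List B} (h : Compat u v) : Compat v u := by
  obtain ⟨Y, h1, h2⟩ := h; exact ⟨Y, h2, h1⟩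

theorem Compat.strip {p u v : List B} (h : Compat (p ++ u) (p ++ v)) : Compat u v := by
  obtain ⟨Y, ⟨t, rfl⟩, h2⟩ := h
  refine ⟨u ++ t, List.prefix_append _ _, ?_⟩
  rw [List.append_assoc] at h2
  exact (List.prefix_append_right_inj p).1 h2

theorem Compat.split {p q u v : List B} (h : Compat (p ++ u) (q ++ v)) (hl : q.length ≤ p.length) :
    ∃ t, p = q ++ t := by
  obtain ⟨Y, h1, h2⟩ := h
  obtain ⟨t, ht⟩ := List.prefix_of_prefix_length_le ((List.prefix_append q v).trans h2)
    ((List.prefix_append p u).trans h1) hl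
  exact ⟨t, ht.symm⟩

/-- A long relation with prescribed first letters. -/
def Rel (τ : D → List B) (N : ℕ) (d e : D) : Prop :=
  ∃ u v : List D, N ≤ u.length ∧ N ≤ v.length ∧
    Compat (wordApply τ (d :: u)) (wordApply τ (e :: v))

theorem Rel.symm {τ : D → List B} {N : ℕ} {d e : D} (h : Rel τ N d e) : Rel τ N e d := by
  obtain ⟨u, v, h1, h2, h3⟩ := h; exact ⟨v, u, h2, h1, h3.symm⟩

theorem Rel.mono {τ : D → List B} {N M : ℕ} {d e : D} (h : Rel τ N d e) (hM : M ≤ N) :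
    Rel τ M d e := by
  obtain ⟨u, v, h1, h2, h3⟩ := h; exact ⟨u, v, by omega, by omega, h3⟩

open Classical in
/-- the elementary substitution `d ↦ e d` -/
noncomputable def th (d e : D) : D → List D := fun c => if c = d then [e, d] else [c]

theorem th_ne (d e : D) : NonErasing (th d e) := by
  intro c; unfold th; split <;> simp

theorem th_head {d e : D} (hde : d ≠ e) (c : D) : ∃ f t, f ≠ d ∧ th d e c = f :: t := by
  unfold th; split
  · exact ⟨e, [d], hde.symm, rfl⟩
  · exact ⟨c, [], by assumption, rfl⟩

/-- merging `d` into `e` -/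
theorem merge_fac {τ : D → List B} {d e : D} (hde : d ≠ e) (h : τ d = τ e) {r : ℕ}
    (hf : Fac (fun x : {x : D // x ≠ d} => τ x) r) : Fac τ r := by
  classical
  refine hf.precomp (fun c => if hc : c = d then [⟨e, hde.symm⟩] else [⟨c, hc⟩]) ?_
  intro a
  by_cases hc : a = d
  · subst hc; simp [wordApply, h]
  · simp [wordApply, hc]

theorem card_ne [Fintype D] (d : D) [Fintype {x : D // x ≠ d}] :
    Fintype.card {x : D // x ≠ d} + 1 = Fintype.card D := by
  classical
  have h1 : Fintype.card {x : D // x ≠ d} = Fintype.card D - 1 := by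
    rw [← Set.card_ne_eq d]
    exact Fintype.card_congr (Equiv.refl _)
  have h2 : 0 < Fintype.card D := Fintype.card_pos_iff.2 ⟨d⟩
  omega

/-- the merging on words -/
theorem merge_word {τ : D → List B} {d e : D} (hde : d ≠ e) (h : τ d = τ e) (u : List D) :
    ∃ u' : List {x : D // x ≠ d}, u'.length = u.length ∧
      wordApply (fun x : {x : D // x ≠ d} => τ x) u' = wordApply τ u := by
  induction u with
  | nil => exact ⟨[], rfl, rfl⟩
  | cons a u ih =>
    obtain ⟨u', h1, h2⟩ := ih
    by_cases hc : a = d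
    · subst hc
      exact ⟨⟨e, hde.symm⟩ :: u', by simp [h1], by simp [wordApply, h2, h]⟩
    · exact ⟨⟨a, hc⟩ :: u', by simp [h1], by simp [wordApply, h2]⟩

section upd
variable {τ : D → List B} {d e : D} {t : List B}

open Classical in
/-- the shortened morphism -/
noncomputable def upd (τ : D → List B) (d : D) (t : List B) : D → List B :=
  fun c => if c = d then t else τ c

theorem upd_spec (hde : d ≠ e) (h : τ d = τ e ++ t) (c : D) :
    τ c = wordApply (upd τ d t) (th d e c) := by
  unfold th upd
  by_cases hc : c = d
  · subst hc; simp [wordApply, h, hde.symm]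
  · simp [wordApply, hc]

theorem upd_word (hde : d ≠ e) (h : τ d = τ e ++ t) (u : List D) :
    wordApply τ u = wordApply (upd τ d t) (wordApply (th d e) u) := by
  rw [wordApply_comp]; exact wordApply_congr (upd_spec hde h) u

theorem upd_ne (hτ : NonErasing τ) (ht : t ≠ []) : NonErasing (upd τ d t) := by
  intro c; unfold upd; split
  · exact ht
  · exact hτ c

theorem upd_len [Fintype D] (hτ : NonErasing τ) (h : τ d = τ e ++ t) :
    totalLen (upd τ d t) < totalLen τ := by
  unfold totalLen
  have := List.length_pos_of_ne_nil (hτ e)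
  apply Finset.sum_lt_sum
  · intro i _
    unfold upd; split
    · rename_i hc; subst hc; simp [h]
    · rfl
  · refine ⟨d, Finset.mem_univ _, ?_⟩
    simp [upd, h]; omega

/-- the relation `d ~ e` becomes a relation `d ~ c` with `c ≠ d`. -/
theorem rel_self (hde : d ≠ e) (h : τ d = τ e ++ t) {N : ℕ} (hr : Rel τ (N + 1) d e) :
    ∃ c, c ≠ d ∧ Rel (upd τ d t) N d c := by
  obtain ⟨u, v, h1, h2, h3⟩ := hr
  rw [upd_word hde h, upd_word hde h] at h3
  match v, h2 with
  | f :: v, h2 =>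
    obtain ⟨g, s, hg, hs⟩ := th_head hde f
    refine ⟨g, hg, wordApply (th d e) u, s ++ wordApply (th d e) v, ?_, ?_, ?_⟩
    · have := length_le_wordApply (th_ne d e) u; omega
    · have := length_le_wordApply (th_ne d e) v
      simp at h2 ⊢; omega
    · have e1 : th d e d = [e, d] := by simp [th]
      have e2 : th d e e = [e] := by simp [th, hde.symm]
      simp only [wordApply, e1, e2, hs, List.cons_append, List.nil_append] at h3 ⊢
      exact h3.strip

open Classical in
theorem rel_other (hde : d ≠ e) (h : τ d = τ e ++ t) {N : ℕ} {a b : D} (hr : Rel τ N a b) :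
    Rel (upd τ d t) N (if a = d then e else a) (if b = d then e else b) := by
  obtain ⟨u, v, h1, h2, h3⟩ := hr
  rw [upd_word hde h, upd_word hde h] at h3
  have key : ∀ (a : D) (u : List D), N ≤ u.length → ∃ u', N ≤ u'.length ∧
      wordApply (th d e) (a :: u) = (if a = d then e else a) :: u' := by
    intro a u hu
    have := length_le_wordApply (th_ne d e) u
    by_cases hc : a = d
    · refine ⟨d :: wordApply (th d e) u, by simp; omega, by simp [wordApply, th, hc]⟩
    · refine ⟨wordApply (th d e) u, by omega, by simp [wordApply, th, hc]⟩
  obtain ⟨u', hu1, hu2⟩ := key a u h1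
  obtain ⟨v', hv1, hv2⟩ := key b v h2
  rw [hu2, hv2] at h3
  refine ⟨u', v', hu1, hv1, ?_⟩
  convert h3

end upd

theorem totalLen_pos [Fintype D] {τ : D → List B} (hτ : NonErasing τ) (d : D) :
    0 < totalLen τ := by
  have := List.length_pos_of_ne_nil (hτ d)
  exact lt_of_lt_of_le this
    (Finset.single_le_sum (f := fun a => (τ a).length) (fun _ _ => Nat.zero_le _)
      (Finset.mem_univ d))

theorem claim1 {D : Type*} [Fintype D] (n : ℕ) : ∀ (τ : D → List B) (_ : NonErasing τ) (d e : D),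
    totalLen τ ≤ n → d ≠ e → Rel τ (totalLen τ) d e → ∃ r, r < Fintype.card D ∧ Fac τ r := by
  classical
  induction n with
  | zero =>
    intro τ hτ d e hn
    have := totalLen_pos hτ d; omega
  | succ n ih =>
    intro τ hτ d e hn hde hr
    wlog hl : (τ e).length ≤ (τ d).length generalizing d e
    · exact this e d hde.symm hr.symm (by omega)
    have hsp : ∃ t, τ d = τ e ++ t := by
      obtain ⟨u, v, -, -, h3⟩ := hr
      simp only [wordApply] at h3
      exact h3.split hl
    obtain ⟨t, ht⟩ := hsp
    by_cases h0 : t = []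
    · subst h0
      rw [List.append_nil] at ht
      refine ⟨_, ?_, merge_fac hde ht (fac_card _ fun x => hτ x)⟩
      have := card_ne d; omega
    · have hlt := upd_len hτ ht
      obtain ⟨c, hc, hrc⟩ := rel_self hde ht (N := totalLen τ - 1) (hr.mono (by omega))
      obtain ⟨r, h1, h2⟩ := ih (upd τ d t) (upd_ne hτ h0) d c (by omega) hc.symm
        (hrc.mono (by omega))
      exact ⟨r, h1, h2.precomp _ (upd_spec hde ht)⟩

theorem claim2 {D : Type*} [Fintype D] (n : ℕ) : ∀ (τ : D → List B) (_ : NonErasing τ)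
    (d e d' e' : D), totalLen τ ≤ n → d ≠ e → d' ≠ e' → ¬ (d = d' ∧ e = e') →
    ¬ (d = e' ∧ e = d') → Rel τ (totalLen τ) d e → Rel τ (totalLen τ) d' e' →
    ∃ r, r + 1 < Fintype.card D ∧ Fac τ r := by
  classical
  induction n with
  | zero =>
    intro τ hτ d e _ _ hn
    have := totalLen_pos hτ d; omega
  | succ n ih =>
    intro τ hτ d e d' e' hn hde hde' hn1 hn2 hr hr'
    wlog hl : (τ e).length ≤ (τ d).length generalizing d e
    · exact this e d hde.symm (by tauto) (by tauto) hr.symm (by omega)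
    have hsp : ∃ t, τ d = τ e ++ t := by
      obtain ⟨u, v, -, -, h3⟩ := hr
      simp only [wordApply] at h3
      exact h3.split hl
    obtain ⟨t, ht⟩ := hsp
    by_cases h0 : t = []
    · subst h0
      rw [List.append_nil] at ht
      have hcard := card_ne d
      have hlen : totalLen (fun x : {x : D // x ≠ d} => τ x) ≤ totalLen τ := by
        unfold totalLen
        rw [← Finset.sum_subtype (Finset.univ.filter fun x => x ≠ d) (by simp)
          (fun x => (τ x).length)]
        exact Finset.sum_le_sum_of_subset (Finset.filter_subset _ _)
      obtain ⟨u, v, h1, h2, h3⟩ := hr'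
      let g : D → {x : D // x ≠ d} := fun c => if hc : c = d then ⟨e, hde.symm⟩ else ⟨c, hc⟩
      have hg : ∀ c, τ (g c) = τ c := by
        intro c; by_cases hc : c = d
        · simp [g, hc, ht]
        · simp [g, hc]
      obtain ⟨u', hu1, hu2⟩ := merge_word hde ht u
      obtain ⟨v', hv1, hv2⟩ := merge_word hde ht v
      obtain ⟨r, hr1, hr2⟩ := claim1 _ (fun x : {x : D // x ≠ d} => τ x) (fun x => hτ x)
        (g d') (g e') le_rfl (by
          intro hh
          by_cases c1 : d' = d <;> by_cases c2 : e' = d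
          · exact hde' (c1.trans c2.symm)
          · simp [g, c1, c2] at hh; tauto
          · simp [g, c1, c2] at hh; tauto
          · simp [g, c1, c2] at hh; tauto)
        ⟨u', v', by omega, by omega, by
          simp only [wordApply, hg, hu2, hv2] at h3 ⊢; exact h3⟩
      exact ⟨r, by omega, merge_fac hde ht hr2⟩
    · have hlt := upd_len hτ ht
      obtain ⟨c, hc, hrc⟩ := rel_self hde ht (N := totalLen τ - 1) (hr.mono (by omega))
      have hro := rel_other hde ht hr'
      have k1 : (if d' = d then e else d') ≠ d := by split <;> [exact hde.symm; assumption]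
      have k2 : (if e' = d then e else e') ≠ d := by split <;> [exact hde.symm; assumption]
      obtain ⟨r, h1, h2⟩ := ih (upd τ d t) (upd_ne hτ h0) d c _ _ (by omega) hc.symm
        (by
          by_cases c1 : d' = d <;> by_cases c2 : e' = d
          · exact absurd (c1.trans c2.symm) hde'
          · simp only [c1, c2, if_true, if_false]; rintro rfl; exact hn1 ⟨c1.symm, rfl⟩
          · simp only [c1, c2, if_true, if_false]; rintro rfl; exact hn2 ⟨c2.symm, rfl⟩
          · simpa only [c1, c2, if_true, if_false] using hde')
        (fun h => k1 h.1.symm) (fun h => k2 h.1.symm)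
        (hrc.mono (by omega)) (hro.mono (by omega))
      exact ⟨r, h1, h2.precomp _ (upd_spec hde ht)⟩

end Recog

namespace Recog

variable {A B C D : Type*}

theorem factor_def (y : ℤ → B) (p : ℤ) (m : ℕ) :
    factor y p m = (List.range m).map fun j : ℕ => y (p + (j : ℤ)) := by
  unfold factor
  induction m with
  | zero => rfl
  | succ m ih =>
    simp only [List.range_succ, List.map_append, List.bind_eq_flatMap, List.flatMap_append] at *
    rw [ih]; rfl

theorem factor_length (y : ℤ → B) (p : ℤ) (m : ℕ) : (factor y p m).length = m := by
  simp [factor]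

theorem factor_add (y : ℤ → B) (p : ℤ) (m n : ℕ) :
    factor y p (m + n) = factor y p m ++ factor y (p + m) n := by
  simp only [factor_def]
  rw [List.range_add, List.map_append, List.map_map]
  congr 1
  apply List.map_congr_left
  intro j _
  simp [add_assoc]

theorem factor_succ (y : ℤ → B) (p : ℤ) (n : ℕ) :
    factor y p (n + 1) = y p :: factor y (p + 1) n := by
  rw [add_comm, factor_add]; simp [factor_def]

theorem factor_eq_iff (y z : ℤ → B) (p q : ℤ) (n : ℕ) :
    factor y p n = factor z q n ↔ ∀ j : ℕ, j < n → y (p + j) = z (q + j) := by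
  simp only [factor_def]
  rw [List.map_inj_left]
  simp

theorem factor_compat (y : ℤ → B) (p : ℤ) (m n : ℕ) : Compat (factor y p m) (factor y p n) := by
  refine ⟨factor y p (max m n), ?_, ?_⟩
  · obtain ⟨k, hk⟩ := Nat.exists_eq_add_of_le (le_max_left m n)
    rw [hk, factor_add]; exact List.prefix_append _ _
  · obtain ⟨k, hk⟩ := Nat.exists_eq_add_of_le (le_max_right m n)
    rw [hk, factor_add]; exact List.prefix_append _ _

/-- a tiling of `y` with cutting points `c` -/
structure Til (σ : D → List B) (y : ℤ → B) (c : ℤ → ℤ) (x : ℤ → D) : Prop where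
  step : ∀ l, c (l + 1) = c l + (σ (x l)).length
  val : ∀ l, σ (x l) = factor y (c l) (σ (x l)).length

theorem Til.word {σ : D → List B} {y : ℤ → B} {c : ℤ → ℤ} {x : ℤ → D} (h : Til σ y c x)
    (n : ℕ) : ∀ i, wordApply σ (factor x i n) =
      factor y (c i) (wordApply σ (factor x i n)).length ∧
      c (i + n) = c i + (wordApply σ (factor x i n)).length := by
  induction n with
  | zero => intro i; simp [factor, wordApply]
  | succ n ih =>
    intro i
    obtain ⟨h1, h2⟩ := ih (i + 1)
    rw [factor_succ]
    constructor
    · simp only [wordApply, List.length_append]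
      rw [factor_add, ← h.val, ← h.step, ← h1]
    · simp only [wordApply, List.length_append]
      push_cast
      rw [show i + (n + 1 : ℤ) = i + 1 + n by ring, h2, h.step]; ring

theorem Til.comp {σ : D → List B} {y : ℤ → B} {c : ℤ → ℤ} {x : ℤ → D} (h : Til σ y c x)
    {α : C → List D} {a : ℤ → ℤ} {w : ℤ → C} (h' : Til α x a w) :
    Til (comp σ α) y (fun l => c (a l)) w := by
  constructor
  · intro l
    have := (h.word (α (w l)).length (a l)).2
    rw [← h'.val, ← h'.step] at this
    exact this
  · intro l
    have := (h.word (α (w l)).length (a l)).1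
    rw [← h'.val] at this
    exact this

theorem Til.lt {σ : D → List B} {y : ℤ → B} {c : ℤ → ℤ} {x : ℤ → D} (h : Til σ y c x)
    (hσ : NonErasing σ) : StrictMono c := by
  apply strictMono_int_of_lt_succ
  intro n
  have := List.length_pos_of_ne_nil (hσ (x n))
  have := h.step n
  omega

theorem strictMono_diff {c : ℤ → ℤ} (h : StrictMono c) (i : ℤ) (n : ℕ) :
    c i + n ≤ c (i + n) := by
  induction n with
  | zero => simp
  | succ n ih =>
    have := h (show i + n < i + (n + 1 : ℕ) by omega)
    push_cast at *; omega

theorem exists_next {c : ℤ → ℤ} (h : StrictMono c) (p : ℤ) : ∃ i, c (i - 1) < p ∧ p ≤ c i := by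
  have h1 : ∃ i, p ≤ c i := by
    refine ⟨0 + (p - c 0).toNat, ?_⟩
    have := strictMono_diff h 0 (p - c 0).toNat
    omega
  have h2 : ∃ b, ∀ z, p ≤ c z → b ≤ z := by
    refine ⟨0 - (c 0 - p + 1).toNat, fun z hz => ?_⟩
    by_contra hlt
    have := strictMono_diff h (0 - (c 0 - p + 1).toNat) (c 0 - p + 1).toNat
    rw [show (0 : ℤ) - (c 0 - p + 1).toNat + (c 0 - p + 1).toNat = 0 by ring] at this
    have := h (not_le.1 hlt)
    omega
  obtain ⟨i, hi, hm⟩ := Int.exists_least_of_bdd h2 h1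
  refine ⟨i, ?_, hi⟩
  by_contra hlt
  have := hm (i - 1) (not_lt.1 hlt)
  omega

def Elem [Fintype D] (σ : D → List B) : Prop := ∀ r, Fac σ r → Fintype.card D ≤ r

section
variable {D : Type*} [Fintype D] {σ : D → List B} {y : ℤ → B} {c c' : ℤ → ℤ} {x x' : ℤ → D}

theorem elem1 (hσ : NonErasing σ) (hE : Elem σ) (h : Til σ y c x) (h' : Til σ y c' x')
    {i i' : ℤ} (he : c i = c' i') : x i = x' i' := by
  by_contra hne
  obtain ⟨r, h1, h2⟩ := claim1 _ σ hσ (x i) (x' i') le_rfl hne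
    ⟨factor x (i + 1) (totalLen σ), factor x' (i' + 1) (totalLen σ),
      by simp [factor_length], by simp [factor_length], by
        rw [← factor_succ, ← factor_succ, (h.word _ i).1, (h'.word _ i').1, he]
        exact factor_compat _ _ _ _⟩
  have := hE r h2
  omega

theorem common_all (hσ : NonErasing σ) (hE : Elem σ) (h : Til σ y c x) (h' : Til σ y c' x')
    {i i' : ℤ} (he : c i = c' i') (n : ℕ) : c (i + n) = c' (i' + n) := by
  induction n with
  | zero => simpa using he
  | succ n ih =>
    have := elem1 hσ hE h h' ih
    push_cast
    rw [← add_assoc, ← add_assoc, h.step, h'.step, ih, this]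

theorem elem2 (hσ : NonErasing σ) (hE : Elem σ) (h : Til σ y c x) (h' : Til σ y c' x')
    {i i' j j' : ℤ} {len : ℕ} (hl : 0 < len) (h1 : c' i' = c i + len) (h2 : c' j' = c j + len)
    (h3 : factor y (c i) len = factor y (c j) len) : x i = x j := by
  by_contra hne
  let τ : Option D → List B := fun o => o.elim (factor y (c i) len) σ
  have hτ : NonErasing τ := by
    intro o; cases o with
    | none =>
      intro h0
      have := factor_length y (c i) len
      simp only [τ, Option.elim] at h0
      rw [h0] at this; simp at this; omega
    | some a => exact hσ a
  have hw : ∀ u : List D, wordApply τ (u.map some) = wordApply σ u := by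
    intro u
    induction u with
    | nil => rfl
    | cons a u ih => simp only [List.map_cons, wordApply, ih]; rfl
  have key : ∀ k k' : ℤ, c' k' = c k + len → factor y (c i) len = factor y (c k) len →
      Rel τ (totalLen τ) none (some (x k)) := by
    intro k k' hk hf
    refine ⟨(factor x' k' (totalLen τ)).map some, (factor x (k + 1) (totalLen τ)).map some,
      by simp [factor_length], by simp [factor_length], ?_⟩
    rw [← List.map_cons, ← factor_succ, hw, (h.word _ k).1]
    simp only [wordApply, hw]
    rw [(h'.word _ k').1]
    have : τ none = factor y (c k) len := hf
    rw [this, hk, ← factor_add]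
    exact factor_compat _ _ _ _
  obtain ⟨r, hr1, hr2⟩ := claim2 _ τ hτ none (some (x i)) none (some (x j)) le_rfl (by simp)
    (by simp) (by simpa using hne) (by simp) (key i i' h1 rfl) (key j j' h2 h3)
  have hf : Fac σ r := hr2.precomp (fun a => [some a]) (fun a => by simp [wordApply, τ])
  have := hE r hf
  simp at hr1
  omega

def Common (c c' : ℤ → ℤ) (p : ℤ) : Prop := (∃ i, c i = p) ∧ ∃ i, c' i = p

theorem Common.symm {p : ℤ} (h : Common c c' p) : Common c' c p := ⟨h.2, h.1⟩

theorem not_common (hc : StrictMono c') {i' p : ℤ} (h1 : c' (i' - 1) < p) (h2 : p < c' i') :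
    ¬ Common c c' p := by
  rintro ⟨-, k, rfl⟩
  have := hc.lt_iff_lt.1 h1
  have := hc.lt_iff_lt.1 h2
  omega

theorem determ (hσ : NonErasing σ) (hE : Elem σ) (m : ℕ) : ∀ (c c' : ℤ → ℤ) (x x' : ℤ → D),
    Til σ y c x → Til σ y c' x' → ∀ (i i' j j' : ℤ) (len : ℕ), 0 < len →
    c' i' = c i + len → c' j' = c j + len → c' (i' - 1) < c i →
    factor y (c i) len = factor y (c j) len →
    (∃ m' : ℕ, m' ≤ m ∧ Common c c' (c i + m') ∧ Common c c' (c j + m')) ∨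
    ((∀ n : ℕ, n < m → y (c i + n) = y (c j + n)) ∧
      ∀ p : ℕ, p ≤ m → ¬ Common c c' (c i + p)) := by
  induction m using Nat.strong_induction_on with
  | _ m ih =>
  intro c c' x x' h h' i i' j j' len hl h1 h2 h3 h4
  have hx := elem2 hσ hE h h' hl h1 h2 h4
  have hm := h.lt hσ
  have hm' := h'.lt hσ
  obtain ⟨L, hL⟩ : ∃ L, L = (σ (x i)).length := ⟨_, rfl⟩
  have hLpos : 0 < L := by rw [hL]; exact List.length_pos_of_ne_nil (hσ _)
  have s1 : c (i + 1) = c i + L := by rw [h.step, hL]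
  have s2 : c (j + 1) = c j + L := by rw [h.step, hL, hx]
  have hag : ∀ n : ℕ, n < L → y (c i + n) = y (c j + n) := by
    rw [← factor_eq_iff]
    have e1 := h.val i
    have e2 := h.val j
    rw [← hx, ← hL] at e2
    rw [← hL] at e1
    exact e1.symm.trans e2
  have hag' := (factor_eq_iff y y (c i) (c j) len).1 h4
  have hnc : ∀ p : ℕ, p < len → ¬ Common c c' (c i + p) := by
    intro p hp
    exact not_common hm' (i' := i') (by omega) (by omega)
  rcases lt_trichotomy L len with hlt | heq | hgt
  · by_cases hmL : m < L
    · exact Or.inr ⟨fun n hn => hag n (by omega), fun p hp => hnc p (by omega)⟩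
    · rcases ih (m - L) (by omega) c c' x x' h h' (i + 1) i' (j + 1) j' (len - L) (by omega)
        (by omega) (by omega) (by omega) (by
          rw [factor_eq_iff]
          intro n hn
          have := hag' (L + n) (by omega)
          push_cast at this
          rw [s1, s2, add_assoc, add_assoc]; exact this) with
        ⟨m', q1, q2, q3⟩ | ⟨q1, q2⟩
      · refine Or.inl ⟨L + m', by omega, ?_, ?_⟩
        · push_cast; rw [← add_assoc, ← s1]; exact q2
        · push_cast; rw [← add_assoc, ← s2]; exact q3
      · refine Or.inr ⟨fun n hn => ?_, fun p hp => ?_⟩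
        · by_cases hn' : n < L
          · exact hag n hn'
          · have := q1 (n - L) (by omega)
            rw [s1, s2, show c i + L + ((n - L : ℕ) : ℤ) = c i + n by omega,
              show c j + L + ((n - L : ℕ) : ℤ) = c j + n by omega] at this
            exact this
        · by_cases hn' : p < L
          · exact hnc p (by omega)
          · have := q2 (p - L) (by omega)
            rw [s1, show c i + L + ((p - L : ℕ) : ℤ) = c i + p by omega] at this
            exact this
  · by_cases hmL : m < L
    · exact Or.inr ⟨fun n hn => hag n (by omega), fun p hp => hnc p (by omega)⟩
    · exact Or.inl ⟨L, by omega, ⟨⟨i + 1, s1⟩, ⟨i', by omega⟩⟩, ⟨⟨j + 1, s2⟩, ⟨j', by omega⟩⟩⟩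
  · by_cases hmL : m < len
    · exact Or.inr ⟨fun n hn => hag n (by omega), fun p hp => hnc p (by omega)⟩
    · rcases ih (m - len) (by omega) c' c x' x h' h i' (i + 1) j' (j + 1) (L - len) (by omega)
        (by omega) (by omega) (by rw [add_sub_cancel_right]; omega) (by
          rw [factor_eq_iff]
          intro n hn
          have := hag (len + n) (by omega)
          push_cast at this
          rw [h1, h2, add_assoc, add_assoc]; exact this) with
        ⟨m', q1, q2, q3⟩ | ⟨q1, q2⟩
      · refine Or.inl ⟨len + m', by omega, ?_, ?_⟩
        · push_cast; rw [← add_assoc, ← h1]; exact q2.symm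
        · push_cast; rw [← add_assoc, ← h2]; exact q3.symm
      · refine Or.inr ⟨fun n hn => ?_, fun p hp => ?_⟩
        · by_cases hn' : n < L
          · exact hag n hn'
          · have := q1 (n - len) (by omega)
            rw [h1, h2, show c i + len + ((n - len : ℕ) : ℤ) = c i + n by omega,
              show c j + len + ((n - len : ℕ) : ℤ) = c j + n by omega] at this
            exact this
        · by_cases hn' : p < len
          · exact hnc p (by omega)
          · have := q2 (p - len) (by omega)
            rw [h1, show c i + len + ((p - len : ℕ) : ℤ) = c i + p by omega] at this
            exact fun hh => this hh.symm

theorem common_unbdd [Finite B] (hσ : NonErasing σ) (hE : Elem σ) (h : Til σ y c x)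
    (h' : Til σ y c' x') (hy : Aperiodic y) (M : ℤ) : ∃ p, p ≤ M ∧ Common c c' p := by
  by_contra hcon
  push Not at hcon
  have hm := h.lt hσ
  have hm' := h'.lt hσ
  choose nx hn1 hn2 using fun i => exists_next hm' (c i)
  have hb : ∀ i, (c' (nx i) - c i).toNat ≤ totalLen σ := by
    intro i
    have e := h'.step (nx i - 1)
    rw [sub_add_cancel] at e
    have : (σ (x' (nx i - 1))).length ≤ totalLen σ :=
      Finset.single_le_sum (f := fun a => (σ a).length) (fun _ _ => Nat.zero_le _)
        (Finset.mem_univ _)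
    have := hn1 i
    omega
  have hfin : Finite {l : List B | l.length ≤ totalLen σ} :=
    (List.finite_length_le B (totalLen σ)).to_subtype
  obtain ⟨i0, hi0⟩ : ∃ i0 : ℤ, c i0 ≤ M := by
    obtain ⟨i, hi, -⟩ := exists_next hm M
    exact ⟨i - 1, hi.le⟩
  let f : ℕ → {l : List B | l.length ≤ totalLen σ} := fun n =>
    ⟨factor y (c (i0 - n)) (c' (nx (i0 - n)) - c (i0 - n)).toNat, by
      simpa [factor_length] using hb (i0 - n)⟩
  obtain ⟨s, hs⟩ := Finite.exists_infinite_fiber f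
  rw [Set.infinite_coe_iff] at hs
  have hS : ∀ p : ℤ, ∃ n, f n = s ∧ c (i0 - n) ≤ p := by
    intro p
    obtain ⟨n, hn, hn'⟩ := hs.exists_gt (c i0 - p).toNat
    refine ⟨n, hn, ?_⟩
    have := strictMono_diff hm (i0 - n) n
    rw [sub_add_cancel] at this
    omega
  have hlen : ∀ n, f n = s → c' (nx (i0 - n)) = c (i0 - n) + s.1.length := by
    intro n hn
    rw [← hn]
    simp only [f, factor_length]
    have := hn2 (i0 - n)
    omega
  have hfac : ∀ n, f n = s → factor y (c (i0 - n)) s.1.length = s.1 := by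
    intro n hn
    rw [← hn]; simp only [f, factor_length]
  obtain ⟨n, hn, -⟩ := hS M
  have hle : ∀ k : ℕ, c (i0 - k) ≤ M := by
    intro k
    have := hm.monotone (show i0 - k ≤ i0 by omega)
    omega
  have hpos : 0 < s.1.length := by
    by_contra h0
    refine hcon (c (i0 - n)) (hle n) ⟨⟨_, rfl⟩, ⟨nx (i0 - n), ?_⟩⟩
    have := hlen n hn
    omega
  have key := fun (k : ℕ) (hk : f k = s) (m : ℕ) => determ hσ hE m c c' x x' h h' (i0 - n)
    (nx (i0 - n)) (i0 - k) (nx (i0 - k)) s.1.length hpos (hlen n hn) (hlen k hk) (hn1 _)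
    ((hfac n hn).trans (hfac k hk).symm)
  by_cases hex : ∃ m : ℕ, Common c c' (c (i0 - n) + m)
  · obtain ⟨m, hmc⟩ := hex
    obtain ⟨k, hk, hkle⟩ := hS (M - m)
    rcases key k hk m with ⟨m', q1, -, q3⟩ | ⟨-, q⟩
    · exact hcon _ (by omega) q3
    · exact q m le_rfl hmc
  · have hag : ∀ k, f k = s → ∀ m : ℕ, y (c (i0 - n) + m) = y (c (i0 - k) + m) := by
      intro k hk m
      rcases key k hk (m + 1) with ⟨m', q1, q2, q3⟩ | ⟨q, -⟩
      · exact absurd ⟨m', q2⟩ hex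
      · exact q m (by omega)
    obtain ⟨k1, hk1, hk1'⟩ := hS (c (i0 - n) - 1)
    obtain ⟨p, hp⟩ : ∃ p : ℕ, c (i0 - n) = c (i0 - k1) + p :=
      ⟨(c (i0 - n) - c (i0 - k1)).toNat, by omega⟩
    refine hy p (by omega) ?_
    funext q
    obtain ⟨k, hk, hk'⟩ := hS q
    obtain ⟨m, hm⟩ : ∃ m : ℕ, q = c (i0 - k) + m := ⟨(q - c (i0 - k)).toNat, by omega⟩
    have e1 := hag k hk m
    have e2 := hag k hk (m + p)
    have e3 := hag k1 hk1 (m + p)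
    rw [hm, ← e1]
    push_cast at e2 e3
    rw [show c (i0 - k) + m + (p : ℤ) = c (i0 - k) + (m + p) by ring, ← e2, e3, hp]
    congr 1; ring

theorem main_elem [Finite B] (hσ : NonErasing σ) (hE : Elem σ) (h : Til σ y c x)
    (h' : Til σ y c' x') (hy : Aperiodic y) :
    ∃ t, ∀ l, c l = c' (l + t) ∧ x l = x' (l + t) := by
  have hm := h.lt hσ
  have hm' := h'.lt hσ
  obtain ⟨p, -, ⟨i, hi⟩, ⟨i', hi'⟩⟩ := common_unbdd hσ hE h h' hy 0
  have key : ∀ l, c l = c' (l + (i' - i)) := by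
    intro l
    obtain ⟨q, hq, ⟨k, hk⟩, ⟨k', hk'⟩⟩ := common_unbdd hσ hE h h' hy (min (c l) (c i))
    have hkk : c k = c' k' := by rw [hk, hk']
    have k1 : k ≤ l := hm.le_iff_le.1 (by omega)
    have k2 : k ≤ i := hm.le_iff_le.1 (by omega)
    have e1 := common_all hσ hE h h' hkk (l - k).toNat
    have e2 := common_all hσ hE h h' hkk (i - k).toNat
    rw [show k + ((l - k).toNat : ℤ) = l by omega] at e1
    rw [show k + ((i - k).toNat : ℤ) = i by omega, hi, ← hi'] at e2
    have := hm'.injective e2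
    rw [e1]; congr 1; omega
  exact ⟨i' - i, fun l => ⟨key l, elem1 hσ hE h h' (key l)⟩⟩

end

end Recog

namespace Recog

variable {A B C D : Type*}

theorem iter_add (σ : A → List A) (k n : ℕ) : ∀ a,
    iter σ (k + n) a = wordApply (iter σ n) (iter σ k a) := by
  induction k with
  | zero => intro a; simp [iter, wordApply]
  | succ k ih =>
    intro a
    rw [show k + 1 + n = (k + n) + 1 by ring]
    simp only [iter]
    rw [wordApply_comp]
    exact wordApply_congr ih _

theorem iter_one (σ : A → List A) (a : A) : iter σ 1 a = σ a := by
  simp only [iter]; exact wordApply_single _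

theorem window [Fintype A] {σ : A → List A} {x : ℤ → A} (hx : x ∈ subX σ) {n : ℕ}
    {β : A → List C} {α : C → List A} (h : ∀ a, iter σ n a = wordApply α (β a)) (N : ℕ) :
    ∃ v : List C, factor x (-N) (2 * N) <:+: wordApply α v := by
  obtain ⟨K, hK⟩ : ∃ K, ∀ m < n, ∀ a, (iter σ m a).length ≤ K := by
    refine ⟨∑ m ∈ Finset.range n, ∑ a, (iter σ m a).length, fun m hm a => ?_⟩
    refine le_trans ?_ (Finset.single_le_sum (f := fun m => ∑ a, (iter σ m a).length)
      (fun _ _ => Nat.zero_le _) (Finset.mem_range.2 hm))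
    exact Finset.single_le_sum (f := fun a => (iter σ m a).length)
      (fun _ _ => Nat.zero_le _) (Finset.mem_univ a)
  obtain ⟨m, a, hma⟩ := hx (factor x (-(N + K + 1 : ℕ)) (2 * (N + K + 1))) ⟨_, _, rfl⟩
  have hlen := hma.length_le
  rw [factor_length] at hlen
  have hmn : n ≤ m := by
    by_contra hlt
    have := hK m (by omega) a
    omega
  obtain ⟨k, rfl⟩ := Nat.exists_eq_add_of_le' hmn
  refine ⟨wordApply β (iter σ k a), ?_⟩
  have e : iter σ (k + n) a = wordApply α (wordApply β (iter σ k a)) := by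
    rw [iter_add, wordApply_comp]; exact wordApply_congr h _
  rw [← e]
  refine List.IsInfix.trans ?_ hma
  refine ⟨factor x (-(N + K + 1 : ℕ)) (K + 1), factor x N (K + 1), ?_⟩
  have e1 : (-(N + K + 1 : ℕ) : ℤ) + ((K + 1 : ℕ) : ℤ) = -N := by push_cast; ring
  have e2 : (-(N + K + 1 : ℕ) : ℤ) + ((K + 1 + 2 * N : ℕ) : ℤ) = N := by push_cast; ring
  have f1 := factor_add x (-(N + K + 1 : ℕ) : ℤ) (K + 1) (2 * N)
  have f2 := factor_add x (-(N + K + 1 : ℕ) : ℤ) (K + 1 + 2 * N) (K + 1)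
  rw [e1] at f1
  rw [e2, f1] at f2
  rw [← f2]
  congr 1
  ring

def Nxt (α : C → List A) (s t : C × ℕ) : Prop :=
  (s.2 + 1 < (α s.1).length ∧ t = (s.1, s.2 + 1)) ∨ (s.2 + 1 = (α s.1).length ∧ t.2 = 0)

theorem code_list [Nonempty C] {α : C → List A} (hα : NonErasing α) (v : List C) :
    ∃ t : ℕ → C × ℕ, (t 0).2 = 0 ∧ ∀ p, p < (wordApply α v).length →
      (α (t p).1)[(t p).2]? = (wordApply α v)[p]? ∧
      (p + 1 < (wordApply α v).length → Nxt α (t p) (t (p + 1))) := by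
  induction v with
  | nil =>
    refine ⟨fun _ => (Classical.arbitrary C, 0), rfl, fun p hp => ?_⟩
    simp [wordApply] at hp
  | cons a v ih =>
    obtain ⟨t, h0, ht⟩ := ih
    have hpos := List.length_pos_of_ne_nil (hα a)
    refine ⟨fun p => if p < (α a).length then (a, p) else t (p - (α a).length),
      by simp [hpos], fun p hp => ?_⟩
    simp only [wordApply, List.length_append] at hp ⊢
    by_cases hlt : p < (α a).length
    · constructor
      · simp [hlt, List.getElem?_append_left hlt]
      · intro hp1
        by_cases hlt1 : p + 1 < (α a).length
        · left; simp [hlt, hlt1]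
        · right
          have : p + 1 = (α a).length := by omega
          simp [hlt, this, h0]
    · obtain ⟨h1, h2⟩ := ht (p - (α a).length) (by omega)
      constructor
      · simp only [hlt, if_false]
        rw [h1, List.getElem?_append_right (by omega)]
      · intro hp1
        have h3 := h2 (by omega)
        have hlt1 : ¬ p + 1 < (α a).length := by omega
        simp only [hlt, hlt1, if_false]
        rw [show p + 1 - (α a).length = p - (α a).length + 1 by omega]
        exact h3

theorem code_window [Nonempty C] {α : C → List A} (hα : NonErasing α) {x : ℤ → A} {N : ℕ}
    {v : List C} (h : factor x (-N) (2 * N) <:+: wordApply α v) :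
    ∃ t : ℤ → C × ℕ, ∀ p : ℤ, -N ≤ p → p + 1 < N →
      (α (t p).1)[(t p).2]? = some (x p) ∧ Nxt α (t p) (t (p + 1)) := by
  obtain ⟨t, -, ht⟩ := code_list hα v
  obtain ⟨pre, suf, e⟩ := h
  have hl : pre.length + 2 * N ≤ (wordApply α v).length := by
    rw [← e]; simp [factor_length]
  refine ⟨fun p => t (pre.length + (p + N).toNat), fun p h1 h2 => ?_⟩
  obtain ⟨g1, g2⟩ := ht (pre.length + (p + N).toNat) (by omega)
  constructor
  · rw [g1, ← e, List.append_assoc, List.getElem?_append_right (by omega),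
      List.getElem?_append_left (by rw [factor_length]; omega), factor_def]
    rw [List.getElem?_map, List.getElem?_range (by omega)]
    simp only [Option.map_some]
    congr 2; omega
  · have := g2 (by omega)
    beta_reduce
    rw [show pre.length + (p + 1 + N).toNat = pre.length + (p + N).toNat + 1 by omega]
    exact this

theorem code_all [Nonempty C] [Fintype C] {α : C → List A} (hα : NonErasing α) {x : ℤ → A}
    (h : ∀ N : ℕ, ∃ v : List C, factor x (-N) (2 * N) <:+: wordApply α v) :
    ∃ t : ℤ → C × ℕ, ∀ p : ℤ,
      (α (t p).1)[(t p).2]? = some (x p) ∧ Nxt α (t p) (t (p + 1)) := by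
  choose v hv using h
  choose t ht using fun N => code_window hα (hv N)
  let U := Filter.hyperfilter ℕ
  have hev : ∀ p : ℤ, ∀ᶠ N in (U : Filter ℕ), (α (t N p).1)[(t N p).2]? = some (x p) ∧
      Nxt α (t N p) (t N (p + 1)) := by
    intro p
    have : ∀ᶠ N in (Filter.atTop : Filter ℕ), (α (t N p).1)[(t N p).2]? = some (x p) ∧
      Nxt α (t N p) (t N (p + 1)) := by
      filter_upwards [Filter.eventually_ge_atTop (p.natAbs + 2)] with N hN
      exact ht N p (by omega) (by omega)
    exact Nat.hyperfilter_le_atTop this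
  have hlim : ∀ p : ℤ, ∃ s : C × ℕ, ∀ᶠ N in (U : Filter ℕ), t N p = s := by
    intro p
    have hfin : ((Set.univ : Set C) ×ˢ (Set.Iio (totalLen α))).Finite :=
      Set.finite_univ.prod (Set.finite_Iio _)
    have : ∀ᶠ N in (U : Filter ℕ), ∃ s ∈ (Set.univ : Set C) ×ˢ (Set.Iio (totalLen α)),
        t N p = s := by
      filter_upwards [hev p] with N hN
      refine ⟨t N p, ⟨trivial, ?_⟩, rfl⟩
      obtain ⟨hlt, -⟩ := List.getElem?_eq_some_iff.1 hN.1
      exact lt_of_lt_of_le hlt (Finset.single_le_sum (f := fun a => (α a).length)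
        (fun _ _ => Nat.zero_le _) (Finset.mem_univ _))
    obtain ⟨s, -, hs⟩ := (Ultrafilter.eventually_exists_mem_iff hfin).1 this
    exact ⟨s, hs⟩
  choose T hT using hlim
  refine ⟨T, fun p => ?_⟩
  obtain ⟨N, h1, h2, h3⟩ := ((hev p).and ((hT p).and (hT (p + 1)))).exists
  rw [h2, h3] at h1
  exact h1

theorem code_til {α : C → List A} (hα : NonErasing α) {x : ℤ → A} {t : ℤ → C × ℕ}
    (ht : ∀ p : ℤ, (α (t p).1)[(t p).2]? = some (x p) ∧ Nxt α (t p) (t (p + 1))) :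
    ∃ a w, Til α x a w := by
  have fwd : ∀ p, (t p).2 = 0 → ∀ j : ℕ, j < (α (t p).1).length → t (p + j) = ((t p).1, j) := by
    intro p hp j
    induction j with
    | zero => intro _; rw [Nat.cast_zero, add_zero]; exact Prod.ext rfl hp
    | succ j ih =>
      intro hj
      have e := ih (by omega)
      have hn := (ht (p + j)).2
      rw [e] at hn
      push_cast
      rw [← add_assoc]
      rcases hn with ⟨-, hn⟩ | ⟨hn, -⟩
      · exact hn
      · simp only at hn; omega
  have bwd : ∀ j : ℕ, ∀ p, (t p).2 = j → t (p - j) = ((t p).1, 0) := by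
    intro j
    induction j with
    | zero => intro p hp; rw [Nat.cast_zero, sub_zero]; exact Prod.ext rfl hp
    | succ j ih =>
      intro p hp
      have hn := (ht (p - 1)).2
      rw [sub_add_cancel] at hn
      rcases hn with ⟨-, hn⟩ | ⟨-, hn⟩
      · have hj : (t (p - 1)).2 = j := by rw [hn] at hp; simpa using hp
        have := ih (p - 1) hj
        push_cast
        rw [show p - ((j : ℤ) + 1) = p - 1 - j by ring, this, hn]
      · omega
  have fin : ∀ p, (t p).2 = 0 → (t (p + (α (t p).1).length)).2 = 0 := by
    intro p hp
    have hpos := List.length_pos_of_ne_nil (hα (t p).1)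
    obtain ⟨L, hL⟩ : ∃ L, (α (t p).1).length = L + 1 := ⟨_, (Nat.succ_pred_eq_of_pos hpos).symm⟩
    have e := fwd p hp L (by omega)
    have hn := (ht (p + L)).2
    rw [e] at hn
    rw [hL]
    push_cast
    rw [← add_assoc]
    rcases hn with ⟨hn, -⟩ | ⟨-, hn⟩
    · simp only at hn; omega
    · exact hn
  let S : {p : ℤ // (t p).2 = 0} → {p : ℤ // (t p).2 = 0} :=
    fun p => ⟨p.1 + (α (t p.1).1).length, fin p.1 p.2⟩
  have hS : Function.Bijective S := by
    constructor
    · have key : ∀ p q : {p : ℤ // (t p).2 = 0}, S p = S q → ¬ p.1 < q.1 := by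
        intro p q hpq hlt
        have e : p.1 + (α (t p.1).1).length = q.1 + (α (t q.1).1).length :=
          congrArg Subtype.val hpq
        have hpos := List.length_pos_of_ne_nil (hα (t q.1).1)
        have := fwd p.1 p.2 (q.1 - p.1).toNat (by omega)
        rw [show p.1 + ((q.1 - p.1).toNat : ℤ) = q.1 by omega] at this
        have h2 := q.2
        rw [this] at h2
        simp only at h2
        omega
      intro p q hpq
      have h1 := key p q hpq
      have h2 := key q p hpq.symm
      exact Subtype.ext (by omega)
    · intro q
      have hb := bwd _ (q.1 - 1) rfl
      have hn := (ht (q.1 - 1)).2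
      rw [sub_add_cancel] at hn
      refine ⟨⟨q.1 - 1 - (t (q.1 - 1)).2, by rw [hb]⟩, Subtype.ext ?_⟩
      simp only [S, hb]
      rcases hn with ⟨-, hn⟩ | ⟨hn, -⟩
      · have := q.2
        rw [hn] at this; simp at this
      · rw [← hn]; push_cast; ring
  let e : Equiv.Perm {p : ℤ // (t p).2 = 0} := Equiv.ofBijective S hS
  let p0 : {p : ℤ // (t p).2 = 0} := ⟨0 - (t 0).2, by rw [bwd _ 0 rfl]⟩
  refine ⟨fun l => ((e ^ l) p0).1, fun l => (t ((e ^ l) p0).1).1, ?_, ?_⟩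
  · intro l
    have : (e ^ (l + 1)) p0 = S ((e ^ l) p0) := by
      rw [add_comm, zpow_one_add]; rfl
    rw [this]
  · intro l
    obtain ⟨⟨p, hp⟩, hpe⟩ : ∃ q, q = (e ^ l) p0 := ⟨_, rfl⟩
    rw [← hpe]
    simp only
    apply List.ext_getElem?
    intro j
    rw [factor_def, List.getElem?_map]
    by_cases hj : j < (α (t p).1).length
    · have h1 := fwd p hp j hj
      have h2 := (ht (p + j)).1
      rw [h1] at h2
      rw [List.getElem?_range hj]
      exact h2
    · rw [List.getElem?_eq_none (by omega), List.getElem?_eq_none (by simpa using hj)]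
      rfl

theorem cut_succ (σ : A → List B) (x : ℤ → A) (l : ℤ) :
    cut σ x (l + 1) = cut σ x l + (σ (x l)).length := by
  unfold cut
  by_cases h0 : 0 ≤ l
  · rw [if_pos h0, if_pos (by omega), show (l + 1).toNat = l.toNat + 1 by omega,
      Finset.sum_range_succ, Int.toNat_of_nonneg h0]
  · rw [if_neg h0]
    by_cases h1 : 0 ≤ l + 1
    · have : l = -1 := by omega
      subst this
      simp
    · rw [if_neg h1, show (-l).toNat = (-(l + 1)).toNat + 1 by omega, Finset.sum_range_succ,
        show -(((-(l + 1)).toNat : ℕ) : ℤ) - 1 = l by omega]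
      ring

theorem rep_til {σ : A → List B} {y : ℤ → B} {k : ℤ} {x : ℤ → A} (h : IsRep σ y k x) :
    Til σ y (fun l => cut σ x l - k) x := by
  constructor
  · intro l; simp only [cut_succ]; ring
  · intro l
    apply List.ext_getElem
    · rw [factor_length]
    · intro j h1 h2
      have := h l j h1
      simp only [factor_def, List.getElem_map, List.getElem_range]
      simp only [List.get_eq_getElem] at this
      rw [← this]; congr 1; ring

theorem const_of_step {g : ℤ → ℤ} (h : ∀ l, g (l + 1) = g l) (l : ℤ) : g l = g 0 := by
  induction l using Int.induction_on with
  | zero => rfl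
  | succ i ih => rw [h, ih]
  | pred i ih => rw [← h, sub_add_cancel, ih]

theorem final [Fintype A] (σ : A → List A) (hσ : NonErasing σ) : RecInAp σ (subX σ) := by
  classical
  have hex : ∃ r n, Fac (iter σ n) r := ⟨_, 0, fac_card _ (fun a => by simp [iter])⟩
  obtain ⟨n, hn⟩ := Nat.find_spec hex
  have hmin : ∀ r, (∃ n, Fac (iter σ n) r) → Nat.find hex ≤ r := fun r hr => Nat.find_min' hex hr
  generalize Nat.find hex = r at hn hmin
  obtain ⟨β, α, hα, hf⟩ := hn
  intro y hy k k' x x' hx hx' hr hr'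
  have hτ : NonErasing (comp σ α) := by
    intro i h0
    have h1 := length_le_wordApply hσ (α i)
    have h2 := List.length_pos_of_ne_nil (hα i)
    unfold comp at h0
    rw [h0] at h1
    simp at h1
    exact hα i h1
  have hE : Elem (comp σ α) := by
    intro r' hr'
    rw [Fintype.card_fin]
    refine hmin r' ⟨n + 1, hr'.precomp β fun a => ?_⟩
    rw [iter_add, wordApply_congr (iter_one σ), hf, wordApply_comp]
    rfl
  have hne : Nonempty (Fin r) := by
    have h1 : 0 < (iter σ n (x 0)).length := by
      have : ∀ n (a : A), 0 < (iter σ n a).length := by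
        intro n
        induction n with
        | zero => intro a; simp [iter]
        | succ n ih =>
          intro a
          simp only [iter]
          have g1 := length_le_wordApply (σ := iter σ n)
            (fun b => List.ne_nil_of_length_pos (ih b)) (σ a)
          have g2 := List.length_pos_of_ne_nil (hσ a)
          omega
      exact this n _
    rw [hf] at h1
    rcases hb : β (x 0) with _ | ⟨i, u⟩
    · rw [hb] at h1; simp [wordApply] at h1
    · exact ⟨i⟩
  obtain ⟨hr, hk0, hk1⟩ := hr
  obtain ⟨hr', hk0', hk1'⟩ := hr'
  have h := rep_til hr
  have h' := rep_til hr'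
  have c0 : cut σ x 0 = 0 := by simp [cut]
  have c0' : cut σ x' 0 = 0 := by simp [cut]
  have c1 : cut σ x 1 = (σ (x 0)).length := by
    have := cut_succ σ x 0; rw [c0] at this; simpa using this
  have c1' : cut σ x' 1 = (σ (x' 0)).length := by
    have := cut_succ σ x' 0; rw [c0'] at this; simpa using this
  set c := fun l => cut σ x l - k with hc
  set c' := fun l => cut σ x' l - k' with hc'
  have d0 : c 0 = -k := by simp [hc, c0]
  have d0' : c' 0 = -k' := by simp [hc', c0']
  have d1 : 0 < c 1 := by simp only [hc, c1]; omega
  have d1' : 0 < c' 1 := by simp only [hc', c1']; omega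
  clear_value c c'
  obtain ⟨t1, ht1⟩ := code_all hα (window hx hf)
  obtain ⟨a, w, haw⟩ := code_til hα ht1
  obtain ⟨t2, ht2⟩ := code_all hα (window hx' hf)
  obtain ⟨a', w', haw'⟩ := code_til hα ht2
  obtain ⟨t, ht⟩ := main_elem hτ hE (h.comp haw) (h'.comp haw') hy
  obtain ⟨q, hq⟩ : ∃ q, ∀ l, a' (l + t) = a l + q := by
    refine ⟨a' (0 + t) - a 0, fun l => ?_⟩
    have := const_of_step (g := fun l => a' (l + t) - a l) (fun l => by
      rw [show l + 1 + t = l + t + 1 by ring, haw.step, haw'.step, (ht l).2]; ring) l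
    omega
  have hxx : ∀ p, x p = x' (p + q) := by
    intro p
    obtain ⟨i, hi1, hi2⟩ := exists_next (haw.lt hα) (p + 1)
    have e1 := haw.val (i - 1)
    have e2 := haw'.val (i - 1 + t)
    have e3 := haw.step (i - 1)
    rw [sub_add_cancel] at e3
    rw [← (ht (i - 1)).2, hq, e1, factor_length, factor_eq_iff] at e2
    have := e2 (p - a (i - 1)).toNat (by omega)
    rw [show a (i - 1) + ((p - a (i - 1)).toNat : ℤ) = p by omega,
      show a (i - 1) + q + ((p - a (i - 1)).toNat : ℤ) = p + q by omega] at this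
    exact this
  have hcc : ∀ p, c p = c' (p + q) := by
    have key := const_of_step (g := fun p => c' (p + q) - c p) (fun p => by
      rw [show p + 1 + q = p + q + 1 by ring, h.step, h'.step, hxx p]; ring)
    have k1 := key (a 0)
    have k2 := (ht 0).1
    rw [hq] at k2
    intro p
    have := key p
    omega
  have hm' := h'.lt hσ
  have hq0 : q = 0 := by
    have e0 := hcc 0
    have e1 := hcc 1
    rw [zero_add] at e0
    have l1 : q < 1 := hm'.lt_iff_lt.1 (by omega)
    have l2 : 0 < 1 + q := hm'.lt_iff_lt.1 (by omega)
    omega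
  subst hq0
  refine ⟨?_, funext fun p => by simpa using hxx p⟩
  have := hcc 0
  rw [zero_add] at this
  omega

end Recog

open Recog in
/-- Every substitution is recognizable in its substitutive shift `X_σ`
for aperiodic points. -/
theorem stmt4 {A : Type*} [Fintype A] (σ : A → List A) (hσ : NonErasing σ) :
    RecInAp σ (subX σ) := by
  exact Recog.final σ hσ
end

section
/- Infection Lemma: Let σ: 𝒜 → ℬ⁺ be a non-erasing morphism between finite alphabets and let y ∈ ℬ^ℤ. If y has 2^{|𝒜|−1}(|𝒜|−1) + 2 σ-representations that pairwise have no common σ-cut, then y is periodic (T^p y = y for some p ≥ 1). -/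
open scoped BigOperators

namespace Recog

section CutLemmas
variable {A B : Type*}

lemma inf_cut_succ (σ : A → List B) (x : ℤ → A) (l : ℤ) :
    cut σ x (l + 1) = cut σ x l + ((σ (x l)).length : ℤ) := by
  unfold cut
  rcases le_or_gt 0 l with h | h
  · obtain ⟨n, rfl⟩ := Int.eq_ofNat_of_zero_le h
    have h1 : (0:ℤ) ≤ (n:ℤ) + 1 := by omega
    have h2 : ((n:ℤ) + 1).toNat = n + 1 := by omega
    rw [if_pos h1, if_pos h, h2, Finset.sum_range_succ]
    simp
  · obtain ⟨n, hn⟩ : ∃ n : ℕ, l = -((n:ℤ) + 1) := ⟨(-l - 1).toNat, by omega⟩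
    subst hn
    have h3 : ¬ (0:ℤ) ≤ -((n:ℤ) + 1) := by omega
    have h4 : (-(-((n:ℤ) + 1))).toNat = n + 1 := by omega
    rw [if_neg h3, h4, Finset.sum_range_succ]
    have e : -((n:ℤ)) - 1 = -((n:ℤ) + 1) := by ring
    rw [e]
    rcases Nat.eq_zero_or_pos n with h0 | h0
    · subst h0; simp
    · have h5 : ¬ (0:ℤ) ≤ -((n:ℤ) + 1) + 1 := by omega
      have h6 : (-(-((n:ℤ) + 1) + 1)).toNat = n := by omega
      rw [if_neg h5, h6]
      ring

lemma inf_cut_zero (σ : A → List B) (x : ℤ → A) : cut σ x 0 = 0 := by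
  simp [cut]

lemma inf_cut_ge (σ : A → List B) (hσ : NonErasing σ) (x : ℤ → A) (n : ℕ) :
    (n : ℤ) ≤ cut σ x n ∧ cut σ x (-(n:ℤ)) ≤ -(n:ℤ) := by
  have hp : ∀ a, 1 ≤ (σ a).length := fun a => List.length_pos_iff.mpr (hσ a)
  induction n with
  | zero => simp [inf_cut_zero]
  | succ n ih =>
    have h1 := inf_cut_succ σ x n
    have h2 := inf_cut_succ σ x (-((n:ℤ)+1))
    have e : -((n:ℤ)+1) + 1 = -(n:ℤ) := by ring
    rw [e] at h2
    have := hp (x n)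
    have := hp (x (-((n:ℤ)+1)))
    push_cast
    constructor <;> omega

lemma inf_cover (σ : A → List B) (hσ : NonErasing σ) (x : ℤ → A) (m : ℤ) :
    ∃ l : ℤ, cut σ x l ≤ m ∧ m < cut σ x l + ((σ (x l)).length : ℤ) := by
  have hmono : StrictMono (cut σ x) := strictMono_int_of_lt_succ fun l => by
    rw [inf_cut_succ]
    have : 1 ≤ (σ (x l)).length := List.length_pos_iff.mpr (hσ _)
    omega
  obtain ⟨l, hl, hmax⟩ := Int.exists_greatest_of_bdd (P := fun l => cut σ x l ≤ m)
    ⟨(m.toNat : ℤ) + 1, fun z hz => by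
      by_contra hc
      have h1 := (inf_cut_ge σ hσ x (m.toNat + 1)).1
      have h2 := hmono (lt_of_not_ge hc)
      push_cast at h1
      have := hz
      omega⟩
    ⟨-((-m).toNat : ℤ), by
      have := (inf_cut_ge σ hσ x (-m).toNat).2
      omega⟩
  refine ⟨l, hl, ?_⟩
  rw [← inf_cut_succ]
  by_contra hc
  have := hmax (l+1) (by omega)
  omega

end CutLemmas

/-- forward deterministic finite state sequences are periodic -/
lemma inf_det {S : Type*} [Fintype S] (s : ℤ → S)
    (h : ∀ m m', s m = s m' → s (m+1) = s (m'+1)) :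
    ∀ m, s (m + ((Fintype.card S).factorial : ℕ)) = s m := by
  have hn : ∀ (k : ℕ) m m', s m = s m' → s (m+k) = s (m'+k) := by
    intro k
    induction k with
    | zero => intro m m' hh; simpa using hh
    | succ k ih =>
      intro m m' hh
      have := h _ _ (ih m m' hh)
      push_cast
      rw [← add_assoc, ← add_assoc]; exact this
  intro m
  obtain ⟨i, j, hij, he⟩ := Fintype.exists_ne_map_eq_of_card_lt
    (fun i : Fin (Fintype.card S + 1) => s (m - (Fintype.card S : ℤ) + (i.1 : ℤ))) (by simp)
  have main : ∀ i j : ℕ, i < j → j ≤ Fintype.card S →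
      s (m - (Fintype.card S : ℤ) + (i : ℤ)) = s (m - (Fintype.card S : ℤ) + (j : ℤ)) →
      s (m + ((Fintype.card S).factorial : ℕ)) = s m := by
    intro i j hij hj he
    have hp : ∀ k : ℕ, s (m + k + (j - i : ℕ)) = s (m + k) := by
      intro k
      have := hn (Fintype.card S - i + k) _ _ he
      have e1 : m - (Fintype.card S : ℤ) + (i:ℤ) + ((Fintype.card S - i + k : ℕ) : ℤ) = m + k := by
        omega
      have e2 : m - (Fintype.card S : ℤ) + (j:ℤ) + ((Fintype.card S - i + k : ℕ) : ℤ)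
          = m + k + (j - i : ℕ) := by omega
      rw [e1, e2] at this
      exact this.symm
    have hq : ∀ q : ℕ, s (m + ((j - i) * q : ℕ)) = s m := by
      intro q
      induction q with
      | zero => simp
      | succ q ih =>
        rw [← ih, ← hp ((j-i)*q)]
        congr 1
        push_cast
        ring
    obtain ⟨q, hq'⟩ := Nat.dvd_factorial (show 0 < j - i by omega) (show j - i ≤ Fintype.card S by omega)
    rw [hq']
    exact hq q
  rcases lt_or_gt_of_ne hij with hl | hl
  · exact main i.1 j.1 hl (by have := j.2; omega) he
  · exact main j.1 i.1 hl (by have := i.2; omega) he.symm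

/-- The case of at most two letters. -/
lemma inf_two {A B : Type*} [Fintype A] (σ : A → List B) (hσ : NonErasing σ) (y : ℤ → B)
    (a b : A) (hab : ∀ c, c = a ∨ c = b)
    (O1 O2 : ℤ → A → Prop)
    (h1 : ∀ t c, O1 t c ∨ O2 t c → ∀ (j : ℕ) (hj : j < (σ c).length), y (t + j) = (σ c).get ⟨j, hj⟩)
    (h2 : ∀ t c, O1 t c → ∃ c', O1 (t + ((σ c).length : ℤ)) c')
    (h2' : ∀ t c, O2 t c → ∃ c', O2 (t + ((σ c).length : ℤ)) c')
    (h3 : ∀ m : ℤ, ∃ t c, O1 t c ∧ t ≤ m ∧ m < t + ((σ c).length : ℤ))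
    (h3' : ∀ m : ℤ, ∃ t c, O2 t c ∧ t ≤ m ∧ m < t + ((σ c).length : ℤ))
    (h4 : ∀ t c c', O1 t c → O2 t c' → False)
    (h5 : ∀ t c t' c' m, O1 t c → O1 t' c' → t ≤ m → m < t + ((σ c).length : ℤ) →
      t' ≤ m → m < t' + ((σ c').length : ℤ) → t = t' ∧ c = c')
    (h5' : ∀ t c t' c' m, O2 t c → O2 t' c' → t ≤ m → m < t + ((σ c).length : ℤ) →
      t' ≤ m → m < t' + ((σ c').length : ℤ) → t = t' ∧ c = c') :
    Periodic y := by
  classical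
  have hp : ∀ a, 0 < (σ a).length := fun a => List.length_pos_iff.mpr (hσ a)
  let Z : ℕ → B := fun j => (σ a).get ⟨j % (σ a).length, Nat.mod_lt _ (hp a)⟩
  let V : ℕ → B := fun j => if hj : j < (σ b).length then (σ b).get ⟨j, hj⟩ else Z (j - (σ b).length)
  let O : ℤ → A → Prop := fun t c => O1 t c ∨ O2 t c
  have H2 : ∀ t c, O t c → ∃ c', O (t + ((σ c).length : ℤ)) c' := by
    rintro t c (h | h)
    · obtain ⟨c', hc⟩ := h2 t c h; exact ⟨c', Or.inl hc⟩
    · obtain ⟨c', hc⟩ := h2' t c h; exact ⟨c', Or.inr hc⟩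
  have Zper : ∀ j, Z (j + (σ a).length) = Z j := by
    intro j; simp [Z]
  -- one-step
  have stepa : ∀ t, O t a → ∀ j : ℕ, (∀ j' < j, ∀ t c, O t c → y (t + j') = Z j') →
      y (t + j) = Z j := by
    intro t ht j ih
    by_cases hj : j < (σ a).length
    · rw [h1 t a ht j hj]
      simp [Z, Nat.mod_eq_of_lt hj]
    · obtain ⟨c', hc'⟩ := H2 t a ht
      have := ih (j - (σ a).length) (by have := hp a; omega) _ c' hc'
      have e : t + ((σ a).length : ℤ) + ((j - (σ a).length : ℕ) : ℤ) = t + j := by omega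
      rw [e] at this
      rw [this, ← Zper (j - (σ a).length)]
      congr 1; omega
  have stepb : ∀ t, O t b → ∀ j : ℕ, (∀ j' < j, ∀ t c, O t c → y (t + j') = Z j') →
      y (t + j) = V j := by
    intro t ht j ih
    by_cases hj : j < (σ b).length
    · rw [h1 t b ht j hj]
      simp [V, hj]
    · obtain ⟨c', hc'⟩ := H2 t b ht
      have := ih (j - (σ b).length) (by have := hp b; omega) _ c' hc'
      have e : t + ((σ b).length : ℤ) + ((j - (σ b).length : ℕ) : ℤ) = t + j := by omega
      rw [e] at this
      rw [this]
      simp [V, hj]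
  have allZ : ∀ N : ℕ, (∀ j < N, V j = Z j) → ∀ j < N, ∀ t c, O t c → y (t + j) = Z j := by
    intro N hN j
    induction j using Nat.strong_induction_on with
    | _ j ih =>
      intro hj t c hc
      have ih' : ∀ j' < j, ∀ t c, O t c → y (t + j') = Z j' := fun j' hj' => ih j' hj' (by omega)
      rcases hab c with rfl | rfl
      · exact stepa t hc j ih'
      · rw [stepb t hc j ih', hN j hj]
  by_cases hV : ∀ j, V j = Z j
  · refine ⟨(σ a).length, hp a, ?_⟩
    funext m
    obtain ⟨t, c, hc, ht, -⟩ := h3 m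
    obtain ⟨j, rfl⟩ : ∃ j : ℕ, m = t + j := ⟨(m - t).toNat, by omega⟩
    have e1 := allZ (j+1) (fun j _ => hV j) j (by omega) t c (Or.inl hc)
    have e2 := allZ (j+(σ a).length+1) (fun j _ => hV j) (j + (σ a).length) (by omega) t c (Or.inl hc)
    rw [Zper, ← e1] at e2
    rw [← e2]
    congr 1; push_cast; ring
  · push Not at hV
    let ℓ := Nat.find hV
    have hℓ : V ℓ ≠ Z ℓ := Nat.find_spec hV
    have hmin : ∀ j < ℓ, V j = Z j := fun j hj => by
      by_contra hc; exact Nat.find_min hV hj hc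
    have preZ := allZ ℓ hmin
    have ya : ∀ t, O t a → y (t + ℓ) = Z ℓ := fun t ht => stepa t ht ℓ preZ
    have yb : ∀ t, O t b → y (t + ℓ) = V ℓ := fun t ht => stepb t ht ℓ preZ
    have letdet : ∀ t c t' c', O t c → O t' c' → y (t + ℓ) = y (t' + ℓ) → c = c' := by
      intro t c t' c' hc hc' he
      rcases hab c with rfl | rfl <;> rcases hab c' with h' | h'
      · exact h'.symm
      · subst h'; rw [ya t hc, yb t' hc'] at he; exact absurd he.symm hℓ
      · subst h'; rw [yb t hc, ya t' hc'] at he; exact absurd he hℓ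
      · exact h'.symm
    -- `y` after an occurrence is determined up to `|c| + ℓ`
    have ydet : ∀ t t' c, O t c → O t' c → ∀ j : ℕ, j < (σ c).length + ℓ → y (t + j) = y (t' + j) := by
      intro t t' c hc hc' j hj
      by_cases hjc : j < (σ c).length
      · rw [h1 t c hc j hjc, h1 t' c hc' j hjc]
      · obtain ⟨d, hd⟩ := H2 t c hc
        obtain ⟨d', hd'⟩ := H2 t' c hc'
        have e1 := preZ (j - (σ c).length) (by omega) _ _ hd
        have e2 := preZ (j - (σ c).length) (by omega) _ _ hd'
        have f1 : t + ((σ c).length : ℤ) + ((j - (σ c).length : ℕ) : ℤ) = t + j := by omega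
        have f2 : t' + ((σ c).length : ℤ) + ((j - (σ c).length : ℕ) : ℤ) = t' + j := by omega
        rw [f1] at e1; rw [f2] at e2
        rw [e1, e2]
    choose t1 c1 ho1 hle1 hlt1 using h3
    choose t2 c2 ho2 hle2 hlt2 using h3'
    let L := ∑ c, (σ c).length
    have hL : ∀ c, (σ c).length ≤ L := fun c =>
      Finset.single_le_sum (f := fun c => (σ c).length) (fun _ _ => Nat.zero_le _) (Finset.mem_univ c)
    let s : ℤ → (A × Fin L) × (A × Fin L) := fun m =>
      ((c1 m, ⟨(m - t1 m).toNat, by have := hL (c1 m); have := hle1 m; have := hlt1 m; omega⟩),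
       (c2 m, ⟨(m - t2 m).toNat, by have := hL (c2 m); have := hle2 m; have := hlt2 m; omega⟩))
    have sdef : ∀ m m', s m = s m' ↔ ((c1 m = c1 m' ∧ m - t1 m = m' - t1 m') ∧
        (c2 m = c2 m' ∧ m - t2 m = m' - t2 m')) := by
      intro m m'
      have := hle1 m; have := hle1 m'; have := hle2 m; have := hle2 m'
      simp only [s, Prod.mk.injEq, Fin.mk.injEq]
      constructor
      · rintro ⟨⟨e1, e2⟩, e3, e4⟩; exact ⟨⟨e1, by omega⟩, e3, by omega⟩
      · rintro ⟨⟨e1, e2⟩, e3, e4⟩; exact ⟨⟨e1, by omega⟩, e3, by omega⟩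
    have same1 : ∀ m, m + 1 < t1 m + ((σ (c1 m)).length : ℤ) →
        t1 (m+1) = t1 m ∧ c1 (m+1) = c1 m := fun m hm =>
      h5 _ _ _ _ (m+1) (ho1 (m+1)) (ho1 m) (hle1 _) (hlt1 _) (by have := hle1 m; omega) hm
    have same2 : ∀ m, m + 1 < t2 m + ((σ (c2 m)).length : ℤ) →
        t2 (m+1) = t2 m ∧ c2 (m+1) = c2 m := fun m hm =>
      h5' _ _ _ _ (m+1) (ho2 (m+1)) (ho2 m) (hle2 _) (hlt2 _) (by have := hle2 m; omega) hm
    have new1 : ∀ m, m + 1 = t1 m + ((σ (c1 m)).length : ℤ) → t1 (m+1) = m + 1 := by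
      intro m hm
      obtain ⟨c', hc'⟩ := h2 _ _ (ho1 m)
      rw [← hm] at hc'
      have := hp c'
      exact (h5 _ _ _ _ (m+1) (ho1 (m+1)) hc' (hle1 _) (hlt1 _) le_rfl (by omega)).1
    have new2 : ∀ m, m + 1 = t2 m + ((σ (c2 m)).length : ℤ) → t2 (m+1) = m + 1 := by
      intro m hm
      obtain ⟨c', hc'⟩ := h2' _ _ (ho2 m)
      rw [← hm] at hc'
      have := hp c'
      exact (h5' _ _ _ _ (m+1) (ho2 (m+1)) hc' (hle2 _) (hlt2 _) le_rfl (by omega)).1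
    have hnot : ∀ m, ¬ (m + 1 = t1 m + ((σ (c1 m)).length : ℤ) ∧
        m + 1 = t2 m + ((σ (c2 m)).length : ℤ)) := by
      rintro m ⟨e1, e2⟩
      obtain ⟨c', hc'⟩ := h2 _ _ (ho1 m)
      obtain ⟨d', hd'⟩ := h2' _ _ (ho2 m)
      rw [← e1] at hc'
      rw [← e2] at hd'
      exact h4 _ _ _ hc' hd'
    -- value of `y` from one covering occurrence
    have yval : ∀ t t' c m m', O t c → O t' c → m - t = m' - t' → t ≤ m + 1 →
        m + 1 < t + ((σ c).length : ℤ) → y (m + 1 + ℓ) = y (m' + 1 + ℓ) := by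
      intro t t' c m m' hc hc' he h1 h2
      have := ydet t t' c hc hc' ((m + 1 - t).toNat + ℓ) (by omega)
      have f1 : t + (((m + 1 - t).toNat + ℓ : ℕ) : ℤ) = m + 1 + ℓ := by omega
      have f2 : t' + (((m + 1 - t).toNat + ℓ : ℕ) : ℤ) = m' + 1 + ℓ := by omega
      rw [f1, f2] at this
      exact this
    have sdet : ∀ m m', s m = s m' → s (m+1) = s (m'+1) := by
      intro m m' hs
      rw [sdef] at hs ⊢
      obtain ⟨⟨a1, a2⟩, a3, a4⟩ := hs
      have l1 := hle1 m; have l1' := hlt1 m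
      have l2 := hle2 m; have l2' := hlt2 m
      have o1 := ho1 m
      have o2 := ho2 m
      have o1' := ho1 m'
      have o2' := ho2 m'
      rw [← a1] at o1'
      rw [← a3] at o2'
      by_cases k1 : m + 1 < t1 m + ((σ (c1 m)).length : ℤ)
      · have s1 := same1 m k1
        have s1' := same1 m' (by rw [← a1]; omega)
        refine ⟨⟨by rw [s1.2, s1'.2, a1], by rw [s1.1, s1'.1]; omega⟩, ?_⟩
        by_cases k2 : m + 1 < t2 m + ((σ (c2 m)).length : ℤ)
        · have s2 := same2 m k2
          have s2' := same2 m' (by rw [← a3]; omega)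
          exact ⟨by rw [s2.2, s2'.2, a3], by rw [s2.1, s2'.1]; omega⟩
        · have s2 := new2 m (by omega)
          have s2' := new2 m' (by rw [← a3]; omega)
          refine ⟨?_, by rw [s2, s2']; ring⟩
          apply letdet _ _ _ _ (Or.inr (ho2 (m+1))) (Or.inr (ho2 (m'+1)))
          rw [s2, s2']
          exact yval _ _ _ _ _ (Or.inl o1) (Or.inl o1') a2 (by omega) k1
      · have k2 : m + 1 < t2 m + ((σ (c2 m)).length : ℤ) := by
          by_contra k2
          exact hnot m ⟨by omega, by omega⟩
        have s2 := same2 m k2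
        have s2' := same2 m' (by rw [← a3]; omega)
        refine ⟨?_, ⟨by rw [s2.2, s2'.2, a3], by rw [s2.1, s2'.1]; omega⟩⟩
        have s1 := new1 m (by omega)
        have s1' := new1 m' (by rw [← a1]; omega)
        refine ⟨?_, by rw [s1, s1']; ring⟩
        apply letdet _ _ _ _ (Or.inl (ho1 (m+1))) (Or.inl (ho1 (m'+1)))
        rw [s1, s1']
        exact yval _ _ _ _ _ (Or.inr o2) (Or.inr o2') a4 (by omega) k2
    have hper := inf_det s sdet
    refine ⟨(Fintype.card ((A × Fin L) × (A × Fin L))).factorial, Nat.factorial_pos _, ?_⟩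
    funext m
    have := (sdef _ _).1 (hper m)
    obtain ⟨⟨a1, a2⟩, -⟩ := this
    have o1 := ho1 m
    have o1' := ho1 (m + ((Fintype.card ((A × Fin L) × (A × Fin L))).factorial : ℕ))
    rw [a1] at o1'
    have l1 := hle1 m
    have l2 := hlt1 m
    have := ydet _ _ _ (Or.inl o1') (Or.inl o1) (m - t1 m).toNat (by omega)
    have f1 : t1 m + ((m - t1 m).toNat : ℤ) = m := by omega
    rw [f1] at this
    rw [← this]
    congr 1
    omega
end Recog

namespace Recog

/-- `y` has local period `d` on the window from `u` to `v`. -/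
def InfPer {B : Type*} (y : ℤ → B) (d u v : ℤ) : Prop := ∀ m, u ≤ m → m + d < v → y m = y (m + d)

/-- breaking position of a period `d` starting from a window around `g`. -/
def InfBrk {B : Type*} (y : ℤ → B) (d S g g' : ℤ) : Prop :=
  (g + S + 1 ≤ g' ∧ y (g' - d) ≠ y g' ∧ InfPer y d (g - S - 1) g') ∨
  (g' ≤ g - S - 1 ∧ y (g' - 1) ≠ y (g' - 1 + d) ∧ InfPer y d g' (g + S + 1))

lemma inf_step {B : Type*} (y : ℤ → B) (d S g : ℤ) (hn : ∃ m, y m ≠ y (m + d))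
    (h : InfPer y d (g - S - 1) (g + S + 1)) : ∃ g', InfBrk y d S g g' := by
  by_cases hr : ∃ m, g - S - 1 ≤ m ∧ y m ≠ y (m + d)
  · obtain ⟨m, ⟨hm1, hm2⟩, hmin⟩ := Int.exists_least_of_bdd
      (P := fun m => g - S - 1 ≤ m ∧ y m ≠ y (m + d)) ⟨g - S - 1, fun z hz => hz.1⟩ hr
    refine ⟨m + d, Or.inl ⟨?_, ?_, ?_⟩⟩
    · by_contra hc
      exact hm2 (h m hm1 (by omega))
    · rw [add_sub_cancel_right]; exact hm2
    · intro z hz1 hz2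
      by_contra hc
      have := hmin z ⟨hz1, hc⟩
      omega
  · push Not at hr
    obtain ⟨m0, hm0⟩ := hn
    obtain ⟨m, hm2, hmax⟩ := Int.exists_greatest_of_bdd
      (P := fun m => y m ≠ y (m + d)) ⟨g - S - 1, fun z hz => by
        by_contra hc
        exact hz (hr z (by omega))⟩ ⟨m0, hm0⟩
    refine ⟨m + 1, Or.inr ⟨?_, ?_, ?_⟩⟩
    · by_contra hc
      exact hm2 (hr m (by omega))
    · rw [add_sub_cancel_right]; exact hm2
    · intro z hz1 hz2
      by_contra hc
      have := hmax z hc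
      omega

lemma inf_kill_eq {B : Type*} (y : ℤ → B) (d S g g' E : ℤ) (hd : 0 < d)
    (hb : InfBrk y d S g g') (hE : d ≤ E) (h : InfPer y d (g' - E - 1) (g' + E + 1)) : False := by
  rcases hb with ⟨_, h2, _⟩ | ⟨_, h2, _⟩
  · have := h (g' - d) (by omega) (by omega)
    rw [sub_add_cancel] at this
    exact h2 this
  · exact h2 (h (g' - 1) (by omega) (by omega))

lemma inf_kill {B : Type*} (y : ℤ → B) (d S g g' e E : ℤ) (hd : 0 < d)
    (hb : InfBrk y d S g g') (hde : d < e) (hS : d ≤ S) (hE : 2 * e ≤ E)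
    (h : InfPer y e (g' - E - 1) (g' + E + 1)) :
    InfPer y e (g - (E - e) - 1) (g + (E - e) + 1) := by
  have key : g' - g < e ∧ g - g' < e := by
    rcases hb with ⟨h1, h2, h3⟩ | ⟨h1, h2, h3⟩
    · by_contra hc
      apply h2
      have a1 := h (g' - e) (by omega) (by omega)
      have a2 := h (g' - d - e) (by omega) (by omega)
      have a3 := h3 (g' - d - e) (by omega) (by omega)
      rw [sub_add_cancel] at a1 a2
      rw [← a1, ← a2, a3]
      congr 1; ring
    · by_contra hc
      apply h2
      have a1 := h (g' - 1) (by omega) (by omega)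
      have a2 := h (g' - 1 + d) (by omega) (by omega)
      have a3 := h3 (g' - 1 + e) (by omega) (by omega)
      rw [a1, a2, a3]
      congr 1; ring
  intro m hm1 hm2
  exact h m (by omega) (by omega)

lemma inf_spread (δ : ℤ) (Q : Finset ℤ) :
    (∀ u ∈ Q, ∀ v ∈ Q, u < v → u + δ ≤ v) → ∀ u ∈ Q, (∀ z ∈ Q, u ≤ z) →
    ∃ v ∈ Q, (∀ z ∈ Q, z ≤ v) ∧ u + ((Q.card : ℤ) - 1) * δ ≤ v := by
  induction Q using Finset.induction_on_max with
  | empty => intro _ u hu; simp at hu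
  | insert a s hs ih =>
    intro hg u hu hmin
    have has : a ∉ s := fun h => lt_irrefl _ (hs a h)
    refine ⟨a, Finset.mem_insert_self _ _, ?_, ?_⟩
    · intro z hz
      rcases Finset.mem_insert.1 hz with rfl | hz
      · exact le_rfl
      · exact (hs z hz).le
    · rw [Finset.card_insert_of_notMem has]
      push_cast
      rcases Finset.mem_insert.1 hu with rfl | hu
      · have : s = ∅ := by
          apply Finset.eq_empty_of_forall_notMem
          intro z hz
          have := hs z hz
          have := hmin z (Finset.mem_insert_of_mem hz)
          omega
        subst this
        simp
      · obtain ⟨v, hv, _, hv2⟩ := ih (fun u hu v hv => hg u (Finset.mem_insert_of_mem hu) v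
          (Finset.mem_insert_of_mem hv)) u hu (fun z hz => hmin z (Finset.mem_insert_of_mem hz))
        have := hg v (Finset.mem_insert_of_mem hv) a (Finset.mem_insert_self _ _) (hs v hv)
        nlinarith

/-- The case of at least three letters. -/
lemma inf_big {A B ι : Type*} [Fintype A] [Fintype ι] (σ : A → List B) (y : ℤ → B)
    (O : ι → ℤ → A → Prop)
    (h1 : ∀ i t c, O i t c → ∀ (j : ℕ) (hj : j < (σ c).length), y (t + j) = (σ c).get ⟨j, hj⟩)
    (h2 : ∀ i t c, O i t c → ∃ c', O i (t + ((σ c).length : ℤ)) c')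
    (h3 : ∀ i (m : ℤ), ∃ t c, O i t c ∧ t ≤ m ∧ m < t + ((σ c).length : ℤ))
    (h4 : ∀ i j t c c', i ≠ j → O i t c → O j t c' → False)
    (hn : 3 ≤ Fintype.card A)
    (hK : Fintype.card ι = 2 ^ (Fintype.card A - 1) * (Fintype.card A - 1) + 2) :
    Periodic y := by
  classical
  by_contra hnp
  have hap : ∀ d : ℕ, 0 < d → ∃ m : ℤ, y m ≠ y (m + (d:ℤ)) := by
    intro d hd
    by_contra hc
    push Not at hc
    exact hnp ⟨d, hd, funext fun m => (hc m).symm⟩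
  have same : ∀ i i' t t' c, O i t c → O i' t' c → ∀ r : ℤ, 0 ≤ r → r < ((σ c).length : ℤ) →
      y (t + r) = y (t' + r) := by
    intro i i' t t' c ho ho' r hr hr'
    obtain ⟨j, rfl⟩ := Int.eq_ofNat_of_zero_le hr
    rw [h1 i t c ho j (by omega), h1 i' t' c ho' j (by omega)]
  let D : A → Set ℕ := fun a => {d | 1 ≤ d ∧ ∃ i j t, O i t a ∧ O j (t + (d:ℤ)) a}
  let δ : A → ℕ := fun a => sInf (D a)
  have hδle : ∀ a d, d ∈ D a → δ a ≤ d := fun a d hd => Nat.sInf_le hd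
  have hδpos : ∀ a d, d ∈ D a → 0 < δ a := fun a d hd => (Nat.sInf_mem ⟨d, hd⟩).1
  have hδmem : ∀ a, 0 < δ a → δ a ∈ D a := fun a h => Nat.sInf_mem (Nat.nonempty_of_pos_sInf h)
  have occper : ∀ i t a, 0 < δ a → O i t a →
      InfPer y (δ a) t (t + ((σ a).length : ℤ)) := by
    intro i t a hpos ho m hm1 hm2
    obtain ⟨_, i0, j0, t0, hi0, hj0⟩ := hδmem a hpos
    have e1 := same _ _ _ _ _ ho hj0 (m - t) (by omega) (by omega)
    have e2 := same _ _ _ _ _ ho hi0 (m - t + δ a) (by omega) (by omega)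
    have f1 : t + (m - t) = m := by ring
    have f2 : t + (m - t + (δ a : ℤ)) = m + δ a := by ring
    rw [f1] at e1
    rw [f2] at e2
    rw [e1, e2]
    congr 1; ring
  have h3' : ∀ i (g : ℤ), ∃ t c, O i t c ∧ t ≤ g - 1 ∧ g - 1 < t + ((σ c).length : ℤ) :=
    fun i g => h3 i (g - 1)
  choose T X hO hle hlt using h3'
  let M : A → ℤ → Finset ι := fun a g =>
    Finset.univ.filter fun i => g < T i g + ((σ (X i g)).length : ℤ) ∧ X i g = a
  have memM : ∀ a g i, i ∈ M a g → O i (T i g) a ∧ T i g ≤ g - 1 ∧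
      g < T i g + ((σ a).length : ℤ) := by
    intro a g i hi
    simp only [M, Finset.mem_filter, Finset.mem_univ, true_and] at hi
    obtain ⟨hi1, hi2⟩ := hi
    have := hO i g
    rw [hi2] at this hi1
    exact ⟨this, hle i g, hi1⟩
  have count : ∀ g, Fintype.card ι ≤ (∑ a, (M a g).card) + 1 := by
    intro g
    let P : ι → Prop := fun i => g < T i g + ((σ (X i g)).length : ℤ)
    have e1 : ∑ a, (M a g).card = (Finset.univ.filter P).card := by
      rw [Finset.card_eq_sum_card_fiberwise (f := fun i => X i g) (t := Finset.univ)
        (fun _ _ => by simp)]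
      apply Finset.sum_congr rfl
      intro a _
      rw [Finset.filter_filter]
    have e2 : (Finset.univ.filter fun i => ¬ P i).card ≤ 1 := by
      rw [Finset.card_le_one]
      intro i hi j hj
      simp only [P, Finset.mem_filter, Finset.mem_univ, true_and] at hi hj
      by_contra hij
      obtain ⟨c, hc⟩ := h2 _ _ _ (hO i g)
      obtain ⟨c', hc'⟩ := h2 _ _ _ (hO j g)
      have := hlt i g
      have := hlt j g
      have f1 : T i g + ((σ (X i g)).length : ℤ) = g := by omega
      have f2 : T j g + ((σ (X j g)).length : ℤ) = g := by omega
      rw [f1] at hc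
      rw [f2] at hc'
      exact h4 _ _ _ _ _ hij hc hc'
    have e3 := Finset.card_filter_add_card_filter_not (s := (Finset.univ : Finset ι)) P
    rw [Finset.card_univ] at e3
    omega
  -- two occurrences at a gap
  have gap : ∀ a g i j, i ∈ M a g → j ∈ M a g → T i g < T j g →
      0 < δ a ∧ T i g + δ a ≤ T j g := by
    intro a g i j hi hj hlt
    have o1 := memM a g i hi
    have o2 := memM a g j hj
    have hD : (T j g - T i g).toNat ∈ D a := by
      refine ⟨by omega, i, j, T i g, o1.1, ?_⟩
      have : T i g + (((T j g - T i g).toNat : ℕ) : ℤ) = T j g := by omega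
      rw [this]; exact o2.1
    have := hδle a _ hD
    exact ⟨hδpos a _ hD, by omega⟩
  have Tinj : ∀ a g i j, i ∈ M a g → j ∈ M a g → T i g = T j g → i = j := by
    intro a g i j hi hj he
    by_contra hij
    have o1 := (memM a g i hi).1
    have o2 := (memM a g j hj).1
    rw [← he] at o2
    exact h4 _ _ _ _ _ hij o1 o2
  let Ext : A → ℕ → ℤ → Prop := fun a s g =>
    0 < δ a ∧ InfPer y (δ a) (g - (s:ℤ) * δ a - 1) (g + (s:ℤ) * δ a + 1)
  have ExtMono : ∀ a s s' g, s ≤ s' → Ext a s' g → Ext a s g := by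
    rintro a s s' g hs ⟨hp, he⟩
    refine ⟨hp, fun m hm1 hm2 => he m ?_ ?_⟩
    · have : (s:ℤ) * δ a ≤ (s':ℤ) * δ a := by gcongr
      omega
    · have : (s:ℤ) * δ a ≤ (s':ℤ) * δ a := by gcongr
      omega
  have multExt : ∀ a s g, 2 ≤ s → s + 1 ≤ (M a g).card → Ext a s g := by
    intro a s g hs hcard
    let Q := (M a g).image fun i => T i g
    have hQc : Q.card = (M a g).card := Finset.card_image_of_injOn fun i hi j hj he =>
      Tinj a g i j hi hj he
    have memQ : ∀ z ∈ Q, ∃ i, i ∈ M a g ∧ T i g = z := fun z hz => by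
      simpa [Q] using hz
    have hgap : ∀ u ∈ Q, ∀ v ∈ Q, u < v → 0 < δ a ∧ u + δ a ≤ v := by
      intro u hu v hv huv
      obtain ⟨i, hi, rfl⟩ := memQ u hu
      obtain ⟨j, hj, rfl⟩ := memQ v hv
      exact gap a g i j hi hj huv
    have hne : Q.Nonempty := Finset.card_pos.1 (by omega)
    have hu := Q.min'_mem hne
    have humin : ∀ z ∈ Q, Q.min' hne ≤ z := fun z hz => Q.min'_le z hz
    generalize Q.min' hne = u at hu humin
    obtain ⟨v, hv, hvmax, hspread⟩ := inf_spread (δ a) Q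
      (fun u hu v hv h => (hgap u hu v hv h).2) u hu humin
    obtain ⟨w, hw, hwu, hwv⟩ : ∃ w ∈ Q, w ≠ u ∧ w ≠ v := by
      have : 0 < ((Q.erase u).erase v).card := by
        have h1 := Finset.pred_card_le_card_erase (s := Q) (a := u)
        have h2 := Finset.pred_card_le_card_erase (s := Q.erase u) (a := v)
        omega
      obtain ⟨w, hw⟩ := Finset.card_pos.1 this
      simp only [Finset.mem_erase] at hw
      exact ⟨w, hw.2.2, hw.2.1, hw.1⟩
    have g1 := hgap u hu w hw (lt_of_le_of_ne (humin w hw) (Ne.symm hwu))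
    have g2 := hgap w hw v hv (lt_of_le_of_ne (hvmax w hw) hwv)
    have hpos := g1.1
    have hs2 : (s:ℤ) * δ a ≤ ((Q.card : ℤ) - 1) * δ a := by
      have : (s:ℤ) ≤ (Q.card : ℤ) - 1 := by omega
      gcongr
    obtain ⟨iu, hiu, eu⟩ := memQ u hu
    obtain ⟨iv, hiv, ev⟩ := memQ v hv
    obtain ⟨iw, hiw, ew⟩ := memQ w hw
    have ou := memM _ _ _ hiu
    have ov := memM _ _ _ hiv
    have ow := memM _ _ _ hiw
    rw [eu] at ou; rw [ev] at ov; rw [ew] at ow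
    refine ⟨hpos, fun m hm1 hm2 => ?_⟩
    by_cases c1 : m + δ a < u + ((σ a).length : ℤ)
    · exact occper _ _ _ hpos ou.1 m (by omega) (by omega)
    · by_cases c2 : v ≤ m
      · exact occper _ _ _ hpos ov.1 m (by omega) (by omega)
      · exact occper _ _ _ hpos ow.1 m (by omega) (by omega)
  have brkMult : ∀ a S g g', 0 < δ a → InfBrk y (δ a) S g g' → (M a g').card ≤ 1 := by
    intro a S g g' hpos hb
    have aux : ∀ i ∈ M a g', ∀ j ∈ M a g', T i g' < T j g' → False := by
      intro i hi j hj hij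
      have hg := (gap a g' i j hi hj hij).2
      have oi := memM a g' i hi
      have oj := memM a g' j hj
      rcases hb with ⟨_, hb, _⟩ | ⟨_, hb, _⟩
      · have := occper _ _ _ hpos oi.1 (g' - δ a) (by omega) (by omega)
        rw [sub_add_cancel] at this
        exact hb this
      · exact hb (occper _ _ _ hpos oj.1 (g' - 1) (by omega) (by omega))
    rw [Finset.card_le_one]
    intro i hi j hj
    rcases lt_trichotomy (T i g') (T j g') with h | h | h
    · exact (aux i hi j hj h).elim
    · exact Tinj a g' i j hi hj h
    · exact (aux j hj i hi h).elim
  have hKbig : Fintype.card A * Fintype.card A + 1 ≤ Fintype.card ι := by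
    rw [hK]
    obtain ⟨q, hq⟩ : ∃ q, Fintype.card A = q + 1 := ⟨Fintype.card A - 1, by omega⟩
    rw [hq] at hn ⊢
    have hq2 : 2 ≤ q := by omega
    have h2q : q + 2 ≤ 2 ^ q := by
      clear * - hq2
      induction q, hq2 using Nat.le_induction with
      | base => norm_num
      | succ k hk ih => rw [pow_succ]; omega
    simp only [Nat.add_sub_cancel]
    nlinarith
  have stepG : ∀ b k g, 1 ≤ k → Ext b k g → (∀ b', Ext b' k g → δ b' ≤ δ b) →
      ∃ g', (M b g').card ≤ 1 ∧ ∀ b', Ext b' (k+1) g' → δ b' < δ b := by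
    intro b k g hk hb hmax
    have hkd : (δ b : ℤ) ≤ (k:ℤ) * δ b := by
      have : (1:ℤ) ≤ k := by omega
      nlinarith [hb.1]
    obtain ⟨g', hg'⟩ := inf_step y (δ b) ((k:ℤ) * δ b) g (hap _ hb.1) hb.2
    refine ⟨g', brkMult _ _ _ _ hb.1 hg', ?_⟩
    intro b' hb'
    by_contra hc
    have hE : 2 * (δ b' : ℤ) ≤ ((k+1 : ℕ):ℤ) * δ b' := by
      have : (2:ℤ) ≤ ((k+1:ℕ):ℤ) := by omega
      gcongr
    rcases eq_or_lt_of_le (not_lt.1 hc) with he | hl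
    · have h' := hb'.2
      rw [← he] at h' hE
      exact inf_kill_eq y (δ b) _ g g' _ (by have := hb.1; omega) hg' (by omega) h'
    · have h' := inf_kill y (δ b) _ g g' (δ b') _ (by have := hb.1; omega) hg' (by omega) hkd hE hb'.2
      have : Ext b' k g := by
        refine ⟨hb'.1, ?_⟩
        have e : ((k+1 : ℕ):ℤ) * (δ b' : ℤ) - δ b' = (k:ℤ) * δ b' := by push_cast; ring
        rw [e] at h'
        exact h'
      have := hmax b' this
      omega
  have choosemax : ∀ k g, (∃ b, Ext b k g) → ∃ b, Ext b k g ∧ ∀ b', Ext b' k g → δ b' ≤ δ b := by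
    rintro k g ⟨b, hb⟩
    obtain ⟨b0, h0, h1⟩ := Finset.exists_max_image (Finset.univ.filter fun b => Ext b k g) δ
      ⟨b, by simpa using hb⟩
    refine ⟨b0, by simpa using h0, fun b' hb' => h1 b' (by simpa using hb')⟩
  -- inductive statement
  have main : ∀ k : ℕ, k ≤ Fintype.card A → ∃ g a d,
      k + 1 ≤ (Finset.univ.filter fun c => d ≤ δ c).card ∧ (M a g).card ≤ 1 ∧
      ∀ b, Ext b (k+1) g → δ b < d := by
    intro k
    induction k with
    | zero =>
      intro _
      obtain ⟨a0, ha0⟩ : ∃ a, Ext a 1 0 := by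
        by_contra hc
        push Not at hc
        have hm : ∀ a, (M a 0).card ≤ 2 := by
          intro a
          by_contra h
          exact hc a (ExtMono a 1 2 0 (by norm_num) (multExt a 2 0 le_rfl (by omega)))
        have h1 := count 0
        have h2 := Finset.sum_le_card_nsmul Finset.univ (fun a => (M a 0).card) 2 (fun a _ => hm a)
        rw [Finset.card_univ, smul_eq_mul] at h2
        nlinarith
      obtain ⟨a, ha, hmax⟩ := Finset.exists_max_image
        (Finset.univ.filter fun a => ∃ g, Ext a 1 g) δ ⟨a0, by simpa using ⟨0, ha0⟩⟩
      simp only [Finset.mem_filter, Finset.mem_univ, true_and] at ha hmax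
      obtain ⟨g, hg⟩ := ha
      obtain ⟨g', hg'⟩ := inf_step y (δ a) (((1:ℕ):ℤ) * δ a) g (hap _ hg.1) hg.2
      refine ⟨g', a, δ a, ?_, brkMult _ _ _ _ hg.1 hg', ?_⟩
      · exact Finset.card_pos.2 ⟨a, by simp⟩
      · intro b hb
        have hle := hmax b ⟨g', hb⟩
        refine lt_of_le_of_ne hle fun he => ?_
        have h' := hb.2
        rw [he] at h'
        exact inf_kill_eq y (δ a) _ g g' _ (by have := hg.1; omega) hg' (by push_cast; omega) h'
    | succ k ih =>
      intro hk
      obtain ⟨g, a, d, hc, hM, hE⟩ := ih (by omega)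
      by_cases hex : ∃ b, Ext b (k+1) g
      · obtain ⟨b, hb, hmax⟩ := choosemax _ _ hex
        obtain ⟨g', hg1, hg2⟩ := stepG b (k+1) g (by omega) hb hmax
        refine ⟨g', b, δ b, ?_, hg1, hg2⟩
        have hbd := hE b hb
        have hnot : b ∉ Finset.univ.filter fun c => d ≤ δ c := by
          simp only [Finset.mem_filter, Finset.mem_univ, true_and]; omega
        have hsub : insert b (Finset.univ.filter fun c => d ≤ δ c) ⊆
            Finset.univ.filter fun c => δ b ≤ δ c := by
          intro c hc
          simp only [Finset.mem_insert, Finset.mem_filter, Finset.mem_univ, true_and] at hc ⊢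
          rcases hc with rfl | hc
          · exact le_rfl
          · omega
        have := Finset.card_le_card hsub
        rw [Finset.card_insert_of_notMem hnot] at this
        omega
      · exfalso
        push Not at hex
        have hm : ∀ b, (M b g).card ≤ Fintype.card A := by
          intro b
          by_contra h
          exact hex b (ExtMono b (k+1) (Fintype.card A) g hk
            (multExt b (Fintype.card A) g (by omega) (by omega)))
        have h1 := count g
        rw [← Finset.add_sum_erase _ _ (Finset.mem_univ a)] at h1
        have h2 := Finset.sum_le_card_nsmul (Finset.univ.erase a) (fun b => (M b g).card)
          (Fintype.card A) (fun b _ => hm b)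
        rw [Finset.card_erase_of_mem (Finset.mem_univ a), Finset.card_univ, smul_eq_mul] at h2
        obtain ⟨q, hq⟩ : ∃ q, Fintype.card A = q + 1 := ⟨Fintype.card A - 1, by omega⟩
        rw [hq] at h2 hKbig hn
        simp only [Nat.add_sub_cancel] at h2
        nlinarith
  obtain ⟨g, a, d, hc, -, -⟩ := main (Fintype.card A) le_rfl
  have := Finset.card_le_univ (Finset.univ.filter fun c => d ≤ δ c)
  omega

end Recog

open Recog in
/-- Infection Lemma: if `y` has `2^(|𝒜|-1)(|𝒜|-1) + 2` σ-representations with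
pairwise no common σ-cut, then `y` is periodic. -/
theorem stmt7 {A B : Type*} [Fintype A] [Fintype B]
    (σ : A → List B) (hσ : NonErasing σ) (y : ℤ → B)
    (reps : Fin (2 ^ (Fintype.card A - 1) * (Fintype.card A - 1) + 2) → ℤ × (ℤ → A))
    (hreps : ∀ i, IsRep σ y (reps i).1 (reps i).2)
    (hdisj : ∀ i j, i ≠ j →
      cutSet σ (reps i).2 (reps i).1 ∩ cutSet σ (reps j).2 (reps j).1 = ∅) :
    Periodic y := by
  classical
  let O : Fin (2 ^ (Fintype.card A - 1) * (Fintype.card A - 1) + 2) → ℤ → A → Prop :=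
    fun i t c => ∃ l, t = cut σ (reps i).2 l - (reps i).1 ∧ c = (reps i).2 l
  have h1 : ∀ i t c, O i t c → ∀ (j : ℕ) (hj : j < (σ c).length),
      y (t + j) = (σ c).get ⟨j, hj⟩ := by
    rintro i t c ⟨l, rfl, rfl⟩ j hj
    have := hreps i l j hj
    simp only at this
    rw [← this]
    congr 1; ring
  have h2 : ∀ i t c, O i t c → ∃ c', O i (t + ((σ c).length : ℤ)) c' := by
    rintro i t c ⟨l, rfl, rfl⟩
    exact ⟨_, l + 1, by rw [inf_cut_succ]; ring, rfl⟩
  have h3 : ∀ i (m : ℤ), ∃ t c, O i t c ∧ t ≤ m ∧ m < t + ((σ c).length : ℤ) := by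
    intro i m
    obtain ⟨l, hl1, hl2⟩ := inf_cover σ hσ (reps i).2 (m + (reps i).1)
    exact ⟨_, _, ⟨l, rfl, rfl⟩, by omega, by omega⟩
  have h4 : ∀ i j t c c', i ≠ j → O i t c → O j t c' → False := by
    rintro i j t c c' hij ⟨l, hl, -⟩ ⟨l', hl', -⟩
    have : t ∈ cutSet σ (reps i).2 (reps i).1 ∩ cutSet σ (reps j).2 (reps j).1 :=
      ⟨⟨l, hl⟩, ⟨l', hl'⟩⟩
    rw [hdisj i j hij] at this
    exact this
  have h5 : ∀ i t c t' c' m, O i t c → O i t' c' → t ≤ m → m < t + ((σ c).length : ℤ) →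
      t' ≤ m → m < t' + ((σ c').length : ℤ) → t = t' ∧ c = c' := by
    rintro i t c t' c' m ⟨l, rfl, rfl⟩ ⟨l', rfl, rfl⟩ a1 a2 a3 a4
    have hmono : StrictMono (cut σ (reps i).2) := strictMono_int_of_lt_succ fun l => by
      rw [inf_cut_succ]
      have : 1 ≤ (σ ((reps i).2 l)).length := List.length_pos_iff.mpr (hσ _)
      omega
    have b1 := inf_cut_succ σ (reps i).2 l
    have b2 := inf_cut_succ σ (reps i).2 l'
    have c1 : l < l' + 1 := hmono.lt_iff_lt.1 (by omega)
    have c2 : l' < l + 1 := hmono.lt_iff_lt.1 (by omega)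
    have : l = l' := by omega
    subst this
    exact ⟨rfl, rfl⟩
  by_cases hn : 3 ≤ Fintype.card A
  · exact inf_big σ y O h1 h2 h3 h4 hn (Fintype.card_fin _)
  · let i0 : Fin (2 ^ (Fintype.card A - 1) * (Fintype.card A - 1) + 2) := ⟨0, by omega⟩
    let i1 : Fin (2 ^ (Fintype.card A - 1) * (Fintype.card A - 1) + 2) := ⟨1, by omega⟩
    have hne : i0 ≠ i1 := by simp [i0, i1]
    obtain ⟨a, b, hab⟩ : ∃ a b : A, ∀ c, c = a ∨ c = b := by
      let a := (reps i0).2 0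
      by_cases hb : ∃ b, b ≠ a
      · obtain ⟨b, hb⟩ := hb
        refine ⟨a, b, fun c => ?_⟩
        by_contra hc
        push Not at hc
        apply hn
        have : ({a, b, c} : Finset A).card = 3 := by
          rw [Finset.card_eq_three]
          exact ⟨a, b, c, hb.symm, hc.1.symm, hc.2.symm, rfl⟩
        rw [← this]
        exact Finset.card_le_univ _
      · push Not at hb
        exact ⟨a, a, fun c => Or.inl (hb c)⟩
    refine inf_two σ hσ y a b hab (O i0) (O i1) ?_ (h2 i0) (h2 i1) (h3 i0) (h3 i1) ?_ (h5 i0) (h5 i1)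
    · rintro t c (h | h)
      · exact h1 _ _ _ h
      · exact h1 _ _ _ h
    · intro t c c'
      exact h4 i0 i1 t c c' hne
end
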